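/- For the urn process with b(i) = r(i) = w(2i) (the '0'-urn), the expected discrepancy at blue-draw times converges: lim_{n→∞} E[𝔇_{τ_n^𝔅}] = −α/(2α+1). -/

import Mathlib

open MeasureTheory ProbabilityTheory Filter

/-- The asymptotic condition `1/w(n) = n^α (1 + 2B/n + O(1/n²))` on the weight function. -/
def WeightAsymp (w : ℕ → ℝ) (α B : ℝ) : Prop :=
  ∃ C₀ > (0:ℝ), ∃ N₀ : ℕ, ∀ n : ℕ, N₀ ≤ n →
    |1 / w n - (n:ℝ) ^ α - 2 * B * (n:ℝ) ^ (α - 1)| ≤ C₀ * (n:ℝ) ^ (α - 2)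

/-- The three admissible choices of `(b, r)` in terms of the weight function `w`. -/
def UrnChoice (w b r : ℕ → ℝ) : Prop :=
  (∀ i, b i = w (2*i) ∧ r i = w (2*i+1)) ∨
  (∀ i, b i = w (2*i+1) ∧ r i = w (2*i)) ∨
  (∀ i, b i = w (2*i) ∧ r i = w (2*i))

/-- A generalized Pólya urn process: `Bl n` and `Re n` are the numbers of blue and red
balls drawn in the first `n` draws; started at `(0,0)`, exactly one coordinate increases
by `1` at each step, and conditionally on the past the blue coordinate increases with
probability `b(Bl n)/(b(Bl n) + r(Re n))`. -/
structure Urn {Ω : Type*} [MeasurableSpace Ω] (μ : Measure Ω) (b r : ℕ → ℝ) where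
  Bl : ℕ → Ω → ℕ
  Re : ℕ → Ω → ℕ
  meas_Bl : ∀ n, Measurable (Bl n)
  meas_Re : ∀ n, Measurable (Re n)
  init_Bl : ∀ ω, Bl 0 ω = 0
  init_Re : ∀ ω, Re 0 ω = 0
  step : ∀ n ω, (Bl (n+1) ω = Bl n ω + 1 ∧ Re (n+1) ω = Re n ω) ∨
                (Bl (n+1) ω = Bl n ω ∧ Re (n+1) ω = Re n ω + 1)
  markov : ∀ n : ℕ,
    μ[(fun ω => if Bl (n+1) ω = Bl n ω + 1 then (1:ℝ) else 0) |
        ⨆ j ∈ Set.Iic n, MeasurableSpace.comap (fun ω => (Bl j ω, Re j ω)) inferInstance]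
      =ᵐ[μ] fun ω => b (Bl n ω) / (b (Bl n ω) + r (Re n ω))

namespace Urn

variable {Ω : Type*} [MeasurableSpace Ω] {μ : Measure Ω} {b r : ℕ → ℝ}

/-- The discrepancy `𝔇_n = ℜ_n − 𝔅_n`. -/
def D (U : Urn μ b r) (n : ℕ) (ω : Ω) : ℤ := (U.Re n ω : ℤ) - (U.Bl n ω : ℤ)

/-- `τ_k^𝔅`, the number of draws until the `k`-th blue ball. -/
noncomputable def tau (U : Urn μ b r) : ℕ → Ω → ℕ
  | 0 => fun _ => 0
  | k+1 => fun ω => sInf {n : ℕ | U.tau k ω < n ∧ U.Bl n ω = U.Bl (n-1) ω + 1}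

/-- The natural filtration `ℱ_n = σ((𝔅_j, ℜ_j), j ≤ n)`. -/
def F (U : Urn μ b r) (n : ℕ) : MeasurableSpace Ω :=
  ⨆ j ∈ Set.Iic n, MeasurableSpace.comap (fun ω => (U.Bl j ω, U.Re j ω)) inferInstance

end Urn

/-- `e i j` and `g i j` are the probabilities that the urn, whose blue and red weights are both
`1 / a`, leaves the state `(i, j)` by a blue, respectively a red, draw. -/
structure IsFlux (a : ℕ → ℝ) (e g : ℕ → ℕ → ℝ) : Prop where
  e_nonneg : ∀ i j, 0 ≤ e i j
  g_nonneg : ∀ i j, 0 ≤ g i j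
  zero_zero : e 0 0 + g 0 0 = 1
  zero_succ : ∀ j, e 0 (j + 1) + g 0 (j + 1) = g 0 j
  succ_zero : ∀ i, e (i + 1) 0 + g (i + 1) 0 = e i 0
  succ_succ : ∀ i j, e (i + 1) (j + 1) + g (i + 1) (j + 1) = e i (j + 1) + g (i + 1) j
  balance : ∀ i j, a i * e i j = a j * g i j

/-- The expectation of `f` at the exit from the rectangle `[0, n) × [0, N)`. -/
def exitMean (e g : ℕ → ℕ → ℝ) (n N : ℕ) (f : ℕ → ℕ → ℝ) : ℝ :=
  ∑ j ∈ Finset.range N, e (n - 1) j * f n j + ∑ i ∈ Finset.range n, g i (N - 1) * f i N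

/-- The probability that the `N`-th red ball comes before the `n`-th blue ball. -/
def redFirst (g : ℕ → ℕ → ℝ) (n N : ℕ) : ℝ := ∑ i ∈ Finset.range n, g i (N - 1)

/-- The power sum of the first `n` terms of `a`. -/
def powerSum (a : ℕ → ℝ) (k n : ℕ) : ℝ := ∑ l ∈ Finset.range n, a l ^ k

theorem powerSum_succ (a : ℕ → ℝ) (k n : ℕ) :
    powerSum a k (n + 1) = powerSum a k n + a n ^ k := Finset.sum_range_succ _ _

theorem powerSum_zero (a : ℕ → ℝ) (k : ℕ) : powerSum a k 0 = 0 := Finset.sum_range_zero _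

namespace IsFlux

variable {a : ℕ → ℝ} {e g : ℕ → ℕ → ℝ}

theorem const_mul (h : IsFlux a e g) (c : ℝ) : IsFlux (fun l => c * a l) e g :=
  { h with balance := fun i j => by rw [mul_assoc, h.balance, mul_assoc] }

theorem step (h : IsFlux a e g) {f φ : ℕ → ℕ → ℝ}
    (hB : ∀ i j, f (i + 1) j = f i j - a i * φ i j)
    (hR : ∀ i j, f i (j + 1) = f i j + a j * φ i j) (i j : ℕ) :
    e i j * f (i + 1) j + g i j * f i (j + 1) = (e i j + g i j) * f i j := by
  rw [hB, hR]
  linear_combination (-φ i j) * h.balance i j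

theorem exitMean_eq_succ (h : IsFlux a e g) {f φ : ℕ → ℕ → ℝ}
    (hB : ∀ i j, f (i + 1) j = f i j - a i * φ i j)
    (hR : ∀ i j, f i (j + 1) = f i j + a j * φ i j) (n N : ℕ) :
    exitMean e g (n + 1) (N + 1) f = f 0 0 := by
  induction n with
  | zero =>
    induction N with
    | zero =>
      have := h.step hB hR 0 0
      rw [h.zero_zero] at this
      simpa [exitMean] using this
    | succ N ih =>
      have := h.step hB hR 0 (N + 1)
      rw [h.zero_succ] at this
      simp only [exitMean, Finset.sum_range_succ _ (N + 1), Nat.add_sub_cancel] at ih ⊢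
      simp only [zero_add, Finset.sum_range_one] at ih this ⊢
      linarith
  | succ n ih =>
    have key : ∑ j ∈ Finset.range (N + 1), e (n + 1) j * f (n + 2) j
        + g (n + 1) N * f (n + 1) (N + 1) = ∑ j ∈ Finset.range (N + 1), e n j * f (n + 1) j := by
      clear ih
      induction N with
      | zero =>
        have := h.step hB hR (n + 1) 0
        rw [h.succ_zero] at this
        simpa using this
      | succ N ih =>
        have := h.step hB hR (n + 1) (N + 1)
        rw [h.succ_succ] at this
        rw [Finset.sum_range_succ _ (N + 1), Finset.sum_range_succ _ (N + 1)]
        linarith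
    simp only [exitMean, Nat.add_sub_cancel] at ih ⊢
    rw [Finset.sum_range_succ _ (n + 1)]
    linarith

theorem exitMean_eq (h : IsFlux a e g) {f φ : ℕ → ℕ → ℝ}
    (hB : ∀ i j, f (i + 1) j = f i j - a i * φ i j)
    (hR : ∀ i j, f i (j + 1) = f i j + a j * φ i j) {n N : ℕ} (hn : 0 < n) (hN : 0 < N) :
    exitMean e g n N f = f 0 0 := by
  obtain ⟨n, rfl⟩ := Nat.exists_eq_succ_of_ne_zero hn.ne'
  obtain ⟨N, rfl⟩ := Nat.exists_eq_succ_of_ne_zero hN.ne'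
  exact h.exitMean_eq_succ hB hR n N

theorem exitMean_mono (h : IsFlux a e g) {n N : ℕ} {f f' : ℕ → ℕ → ℝ}
    (h₁ : ∀ j < N, f n j ≤ f' n j) (h₂ : ∀ i < n, f i N ≤ f' i N) :
    exitMean e g n N f ≤ exitMean e g n N f' := by
  unfold exitMean
  gcongr with j hj i hi
  · exact h.e_nonneg _ _
  · exact h₁ j (Finset.mem_range.1 hj)
  · exact h.g_nonneg _ _
  · exact h₂ i (Finset.mem_range.1 hi)

theorem sum_add_redFirst (h : IsFlux a e g) {n N : ℕ} (hn : 0 < n) (hN : 0 < N) :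
    ∑ j ∈ Finset.range N, e (n - 1) j + redFirst g n N = 1 := by
  have := h.exitMean_eq (f := fun _ _ => 1) (φ := fun _ _ => 0) (by simp) (by simp) hn hN
  simpa [exitMean, redFirst] using this

theorem redFirst_nonneg (h : IsFlux a e g) (n N : ℕ) : 0 ≤ redFirst g n N :=
  Finset.sum_nonneg fun _ _ => h.g_nonneg _ _

/-- The mean of `M = ∑_{l < j} a l - ∑_{l < i} a l` at the exit vanishes. -/
theorem exitMean_one (h : IsFlux a e g) {n N : ℕ} (hn : 0 < n) (hN : 0 < N) :
    exitMean e g n N (fun i j => powerSum a 1 j - powerSum a 1 i) = 0 := by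
  rw [h.exitMean_eq (φ := fun _ _ => 1) _ _ hn hN]
  · simp
  · intro i j; rw [powerSum_succ]; ring
  · intro i j; rw [powerSum_succ]; ring

theorem exitMean_two (h : IsFlux a e g) {n N : ℕ} (hn : 0 < n) (hN : 0 < N) :
    exitMean e g n N (fun i j => (powerSum a 1 j - powerSum a 1 i) ^ 2
      - (powerSum a 2 j + powerSum a 2 i)) = 0 := by
  rw [h.exitMean_eq (φ := fun i j => 2 * (powerSum a 1 j - powerSum a 1 i)) _ _ hn hN]
  · simp [powerSum_zero]
  · intro i j; simp only [powerSum_succ]; ring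
  · intro i j; simp only [powerSum_succ]; ring

/-- `24` times the fourth elementary symmetric polynomial in `a 0, …, a (j - 1)` and
`-a 0, …, -a (i - 1)`, in terms of power sums, has mean zero at the exit. -/
theorem exitMean_four (h : IsFlux a e g) {n N : ℕ} (hn : 0 < n) (hN : 0 < N) :
    exitMean e g n N (fun i j => (powerSum a 1 j - powerSum a 1 i) ^ 4
      - 6 * (powerSum a 1 j - powerSum a 1 i) ^ 2 * (powerSum a 2 j + powerSum a 2 i)
      + 3 * (powerSum a 2 j + powerSum a 2 i) ^ 2
      + 8 * (powerSum a 1 j - powerSum a 1 i) * (powerSum a 3 j - powerSum a 3 i)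
      - 6 * (powerSum a 4 j + powerSum a 4 i)) = 0 := by
  rw [h.exitMean_eq (φ := fun i j => 4 * (powerSum a 1 j - powerSum a 1 i) ^ 3
    - 12 * (powerSum a 1 j - powerSum a 1 i) * (powerSum a 2 j + powerSum a 2 i)
    + 8 * (powerSum a 3 j - powerSum a 3 i)) _ _ hn hN]
  · simp [powerSum_zero]
  · intro i j; simp only [powerSum_succ]; ring
  · intro i j; simp only [powerSum_succ]; ring

end IsFlux

theorem powerSum_succ_le {a : ℕ → ℝ} {C : ℝ} (k m : ℕ) (ha : ∀ l < m, 0 ≤ a l)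
    (hC : ∀ l < m, a l ≤ C) : powerSum a (k + 1) m ≤ C * powerSum a k m := by
  unfold powerSum
  rw [Finset.mul_sum]
  refine Finset.sum_le_sum fun l hl => ?_
  have hl := Finset.mem_range.1 hl
  rw [pow_succ, mul_comm]
  exact mul_le_mul_of_nonneg_right (hC l hl) (pow_nonneg (ha l hl) k)

theorem powerSum_nonneg {a : ℕ → ℝ} (k m : ℕ) (ha : ∀ l < m, 0 ≤ a l) : 0 ≤ powerSum a k m :=
  Finset.sum_nonneg fun l hl => pow_nonneg (ha l (Finset.mem_range.1 hl)) k

theorem powerSum_two_le {a : ℕ → ℝ} {C : ℝ} (m : ℕ) (ha : ∀ l < m, 0 ≤ a l)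
    (hC : ∀ l < m, a l ≤ C) : powerSum a 2 m ≤ m * C ^ 2 := by
  unfold powerSum
  refine (Finset.sum_le_card_nsmul _ _ (C ^ 2) fun l hl => ?_).trans (by simp)
  have hl := Finset.mem_range.1 hl
  exact pow_le_pow_left₀ (ha l hl) (hC l hl) 2

theorem fourth_moment_pointwise {M Q₂ Q₃ Q₄ C K : ℝ} (h₂ : 0 ≤ Q₂)
    (hK : Q₂ ≤ K) (h₃ : |Q₃| ≤ C * Q₂) (h₄ : Q₄ ≤ C ^ 2 * Q₂) :
    M ^ 4 ≤ (M ^ 4 - 6 * M ^ 2 * Q₂ + 3 * Q₂ ^ 2 + 8 * M * Q₃ - 6 * Q₄)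
      + 10 * K * (M ^ 2 - Q₂) + (10 * K ^ 2 + 10 * C ^ 2 * K) := by
  have h₅ : -(M * Q₃) ≤ |M| * (C * Q₂) := by
    calc -(M * Q₃) ≤ |M * Q₃| := neg_le_abs _
      _ = |M| * |Q₃| := abs_mul _ _
      _ ≤ _ := by gcongr
  have h₆ : 2 * (|M| * (C * Q₂)) ≤ (M ^ 2 + C ^ 2) * Q₂ := by
    have := mul_nonneg (sq_nonneg (|M| - C)) h₂
    nlinarith [sq_abs M]
  have h₇ : M ^ 2 * Q₂ ≤ M ^ 2 * K := by gcongr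
  have h₈ : C ^ 2 * Q₂ ≤ C ^ 2 * K := by gcongr
  have h₉ : Q₂ * K ≤ K * K := mul_le_mul_of_nonneg_right hK (h₂.trans hK)
  nlinarith [sq_nonneg Q₂]

namespace IsFlux

variable {a : ℕ → ℝ} {e g : ℕ → ℕ → ℝ}

theorem exitMean_pow_four_le (h : IsFlux a e g) {n N : ℕ} (hn : 0 < n) (hN : n ≤ N) {C : ℝ}
    (ha : ∀ l, 0 ≤ a l) (hC : ∀ l < N, a l ≤ C) :
    exitMean e g n N (fun i j => (powerSum a 1 j - powerSum a 1 i) ^ 4)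
      ≤ 60 * (N : ℝ) ^ 2 * C ^ 4 := by
  have hN0 : 0 < N := hn.trans_le hN
  have hN1 : (1 : ℝ) ≤ N := by exact_mod_cast hN0
  have hC0 : 0 ≤ C := (ha 0).trans (hC 0 hN0)
  set K : ℝ := 2 * (N * C ^ 2) with hKdef
  have hpt : ∀ i ≤ N, ∀ j ≤ N, (powerSum a 1 j - powerSum a 1 i) ^ 4 ≤
      ((powerSum a 1 j - powerSum a 1 i) ^ 4
      - 6 * (powerSum a 1 j - powerSum a 1 i) ^ 2 * (powerSum a 2 j + powerSum a 2 i)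
      + 3 * (powerSum a 2 j + powerSum a 2 i) ^ 2
      + 8 * (powerSum a 1 j - powerSum a 1 i) * (powerSum a 3 j - powerSum a 3 i)
      - 6 * (powerSum a 4 j + powerSum a 4 i))
      + 10 * K * ((powerSum a 1 j - powerSum a 1 i) ^ 2 - (powerSum a 2 j + powerSum a 2 i))
      + (10 * K ^ 2 + 10 * C ^ 2 * K) := by
    have hp : ∀ m ≤ N, 0 ≤ powerSum a 2 m ∧ powerSum a 2 m ≤ N * C ^ 2 ∧ 0 ≤ powerSum a 3 m ∧
        powerSum a 3 m ≤ C * powerSum a 2 m ∧ powerSum a 4 m ≤ C ^ 2 * powerSum a 2 m := by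
      intro m hm
      have h₀ : ∀ l < m, 0 ≤ a l := fun l _ => ha l
      have h₁ : ∀ l < m, a l ≤ C := fun l hl => hC l (hl.trans_le hm)
      have h3 := powerSum_succ_le 2 m h₀ h₁
      refine ⟨powerSum_nonneg 2 m h₀, (powerSum_two_le m h₀ h₁).trans ?_,
        powerSum_nonneg 3 m h₀, h3, (powerSum_succ_le 3 m h₀ h₁).trans ?_⟩
      · gcongr
      · calc C * powerSum a 3 m ≤ C * (C * powerSum a 2 m) := by gcongr
          _ = _ := by ring
    intro i hi j hj
    obtain ⟨i₁, i₂, i₃, i₄, i₅⟩ := hp i hi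
    obtain ⟨j₁, j₂, j₃, j₄, j₅⟩ := hp j hj
    refine fourth_moment_pointwise (by linarith) (by linarith) ?_ (by linarith)
    rw [abs_le]
    have := mul_nonneg hC0 i₁
    have := mul_nonneg hC0 j₁
    constructor <;> linarith
  refine (h.exitMean_mono (f' := fun i j => ((powerSum a 1 j - powerSum a 1 i) ^ 4
      - 6 * (powerSum a 1 j - powerSum a 1 i) ^ 2 * (powerSum a 2 j + powerSum a 2 i)
      + 3 * (powerSum a 2 j + powerSum a 2 i) ^ 2
      + 8 * (powerSum a 1 j - powerSum a 1 i) * (powerSum a 3 j - powerSum a 3 i)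
      - 6 * (powerSum a 4 j + powerSum a 4 i))
      + 10 * K * ((powerSum a 1 j - powerSum a 1 i) ^ 2 - (powerSum a 2 j + powerSum a 2 i))
      + (10 * K ^ 2 + 10 * C ^ 2 * K)) (fun j hj => hpt n hN j hj.le)
    (fun i hi => hpt i (hi.le.trans hN) N le_rfl)).trans ?_
  have h0 := h.sum_add_redFirst hn hN0
  have h2 := h.exitMean_two hn hN0
  have h4 := h.exitMean_four hn hN0
  have : ∀ (f f' : ℕ → ℕ → ℝ) (c d : ℝ), exitMean e g n N (fun i j => f i j + c * f' i j + d) =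
      exitMean e g n N f + c * exitMean e g n N f' + d := by
    intro f f' c d
    trans exitMean e g n N f + c * exitMean e g n N f' +
      d * (∑ j ∈ Finset.range N, e (n - 1) j + redFirst g n N)
    · simp only [exitMean, redFirst, mul_add, Finset.sum_add_distrib, Finset.mul_sum,
        mul_left_comm _ c, mul_comm _ d]
      ring
    · rw [h0, mul_one]
  rw [this, h2, h4]
  have : (N : ℝ) * C ^ 4 ≤ N ^ 2 * C ^ 4 := by
    have : (N : ℝ) ≤ N ^ 2 := by nlinarith
    gcongr
  rw [hKdef]
  nlinarith

theorem redFirst_mul_le (h : IsFlux a e g) {n N : ℕ} (hn : 0 < n) (hN : n ≤ N) {C : ℝ}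
    (ha : ∀ l, 0 ≤ a l) (hC : ∀ l < N, a l ≤ C) :
    redFirst g n N * (powerSum a 1 N - powerSum a 1 n) ^ 4 ≤ 60 * (N : ℝ) ^ 2 * C ^ 4 := by
  have hm : Monotone (powerSum a 1) :=
    monotone_nat_of_le_succ fun m => by rw [powerSum_succ, pow_one]; linarith [ha m]
  refine le_trans ?_ (h.exitMean_pow_four_le hn hN ha hC)
  unfold redFirst exitMean
  rw [Finset.sum_mul]
  refine le_add_of_nonneg_of_le (Finset.sum_nonneg fun j _ =>
    mul_nonneg (h.e_nonneg _ _) (by positivity)) (Finset.sum_le_sum fun i hi => ?_)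
  have h1 := hm (Finset.mem_range.1 hi).le
  have h2 := hm hN
  have := h.g_nonneg i (N - 1)
  exact mul_le_mul_of_nonneg_left (pow_le_pow_left₀ (by linarith) (by linarith) 4) this

end IsFlux


/-- On `[0, 2n)`, the sequence `a` is comparable to `1` and close to `1 + α (l - n) / n`. -/
structure NearLinear (a : ℕ → ℝ) (n : ℕ) (α C c : ℝ) : Prop where
  two_le : 2 ≤ n
  alpha_pos : 0 < α
  c_pos : 0 < c
  nonneg : ∀ l, 0 ≤ a l
  le_C : ∀ l < 2 * n, a l ≤ C
  c_le : ∀ l < 2 * n, n ≤ 2 * l → c ≤ a l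
  approx : ∀ l < 2 * n,
    |a l - 1 - α * ((l : ℝ) - n) / n| ≤ C * (1 / n + ((l : ℝ) - n) ^ 2 / (n : ℝ) ^ 2)

theorem abs_sub_le_of_abs_step_le {u : ℕ → ℝ} {B : ℝ} {j n : ℕ}
    (h : ∀ l, min j n ≤ l → l < max j n → |u (l + 1) - u l| ≤ B) :
    |u j - u n| ≤ B * |(j : ℝ) - n| := by
  have key : ∀ m k : ℕ, m ≤ k → (∀ l, m ≤ l → l < k → |u (l + 1) - u l| ≤ B) →
      |u k - u m| ≤ B * ((k : ℝ) - m) := by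
    intro m k hmk
    induction k, hmk using Nat.le_induction with
    | base => simp
    | succ k hk ih =>
      intro hs
      have h1 := ih fun l h1 h2 => hs l h1 (h2.trans (Nat.lt_succ_self k))
      have h2 := hs k hk (Nat.lt_succ_self k)
      have h3 := abs_sub_le (u (k + 1)) (u k) (u m)
      push_cast
      linarith
  rcases le_total n j with hj | hj
  · rw [min_eq_right hj, max_eq_left hj] at h
    rw [abs_of_nonneg (sub_nonneg.2 (Nat.cast_le.2 hj))]
    exact key n j hj h
  · rw [min_eq_left hj, max_eq_right hj] at h
    rw [abs_sub_comm, abs_sub_comm (j : ℝ), abs_of_nonneg (sub_nonneg.2 (Nat.cast_le.2 hj))]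
    exact key j n hj h

theorem mul_le_powerSum_one_sub {a : ℕ → ℝ} {c : ℝ} {m k : ℕ} (hmk : m ≤ k)
    (h : ∀ l, m ≤ l → l < k → c ≤ a l) :
    c * ((k : ℝ) - m) ≤ powerSum a 1 k - powerSum a 1 m := by
  induction k, hmk using Nat.le_induction with
  | base => simp
  | succ k hk ih =>
    have h1 := ih fun l h1 h2 => h l h1 (h2.trans (Nat.lt_succ_self k))
    have h2 := h k hk (Nat.lt_succ_self k)
    rw [powerSum_succ]
    push_cast
    linarith

theorem powerSum_one_mono {a : ℕ → ℝ} (ha : ∀ l, 0 ≤ a l) : Monotone (powerSum a 1) :=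
  monotone_nat_of_le_succ fun m => by rw [powerSum_succ, pow_one]; linarith [ha m]

theorem abs_cast_sub_le {j n : ℕ} (hj : j ≤ 2 * n) : |(j : ℝ) - n| ≤ n := by
  have : (j : ℝ) ≤ 2 * n := by exact_mod_cast hj
  have : (0 : ℝ) ≤ j := j.cast_nonneg
  rw [abs_le]; constructor <;> linarith

theorem abs_cast_sub_le_sq (j n : ℕ) : |(j : ℝ) - n| ≤ |(j : ℝ) - n| ^ 2 := by
  have : |(j : ℤ) - n| ≤ |(j : ℤ) - n| ^ 2 := Int.le_self_sq _
  exact_mod_cast this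

namespace NearLinear

variable {a : ℕ → ℝ} {n : ℕ} {α C c : ℝ}

theorem C_nonneg (h : NearLinear a n α C c) : 0 ≤ C :=
  (h.nonneg 0).trans (h.le_C 0 (by have := h.two_le; omega))

theorem cast_pos (h : NearLinear a n α C c) : (0 : ℝ) < n := by
  have := h.two_le
  exact_mod_cast (by omega : 0 < n)

theorem sum_approx (h : NearLinear a n α C c) {j : ℕ} (hj : j < 2 * n) :
    |powerSum a 1 j - powerSum a 1 n - ((j : ℝ) - n) - α * ((j : ℝ) - n) ^ 2 / (2 * n)|
      ≤ (C + α) * (|(j : ℝ) - n| / n + |(j : ℝ) - n| ^ 3 / (n : ℝ) ^ 2) := by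
  have hn := h.cast_pos
  have hα := h.alpha_pos
  have hC := h.C_nonneg
  set u : ℕ → ℝ := fun l => powerSum a 1 l - l
    - α * (((l : ℝ) - n) * ((l : ℝ) - n - 1)) / (2 * n) with hu
  have h1 : |u j - u n| ≤ C * (1 / n + ((j : ℝ) - n) ^ 2 / (n : ℝ) ^ 2) * |(j : ℝ) - n| := by
    refine abs_sub_le_of_abs_step_le fun l hl hl' => ?_
    have e1 : u (l + 1) - u l = a l - 1 - α * ((l : ℝ) - n) / n := by
      simp only [hu, powerSum_succ]
      push_cast
      field_simp
      ring
    rw [e1]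
    refine (h.approx l (hl'.trans_le (by omega))).trans ?_
    have : ((l : ℝ) - n) ^ 2 ≤ ((j : ℝ) - n) ^ 2 := by
      rw [sq_le_sq]
      rcases le_total n j with hnj | hnj
      · have h1 : (n : ℝ) ≤ l := by exact_mod_cast (by omega : n ≤ l)
        have h2 : (l : ℝ) ≤ j := by exact_mod_cast (by omega : l ≤ j)
        rw [abs_of_nonneg (by linarith), abs_of_nonneg (by linarith)]
        linarith
      · have h1 : (j : ℝ) ≤ l := by exact_mod_cast (by omega : j ≤ l)
        have h2 : (l : ℝ) ≤ n := by exact_mod_cast (by omega : l ≤ n)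
        rw [abs_of_nonpos (by linarith), abs_of_nonpos (by linarith)]
        linarith
    gcongr
  have h2 : powerSum a 1 j - powerSum a 1 n - ((j : ℝ) - n) - α * ((j : ℝ) - n) ^ 2 / (2 * n)
      = (u j - u n) - α * ((j : ℝ) - n) / (2 * n) := by
    simp only [hu]
    field_simp
    ring
  have h3 : |α * ((j : ℝ) - n) / (2 * n)| ≤ α * (|(j : ℝ) - n| / n) := by
    rw [abs_div, abs_mul, abs_of_pos hα, abs_of_pos (by linarith : (0 : ℝ) < 2 * n), mul_div_assoc]
    gcongr
    linarith
  have h4 : C * (1 / n + ((j : ℝ) - n) ^ 2 / (n : ℝ) ^ 2) * |(j : ℝ) - n|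
      = C * (|(j : ℝ) - n| / n + |(j : ℝ) - n| ^ 3 / (n : ℝ) ^ 2) := by
    rw [← sq_abs ((j : ℝ) - n)]
    field_simp
  have h5 : 0 ≤ α * (|(j : ℝ) - n| ^ 3 / (n : ℝ) ^ 2) := by positivity
  rw [h2]
  refine (abs_sub _ _).trans ?_
  rw [h4] at h1
  linarith

theorem sum_sq_approx (h : NearLinear a n α C c) {j : ℕ} (hj : j < 2 * n) :
    |(powerSum a 1 j - powerSum a 1 n) ^ 2 - ((j : ℝ) - n) ^ 2|
      ≤ (2 * C + 3 * α) * (2 * C + 3 * α + 2) * (|(j : ℝ) - n| ^ 3 / n) := by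
  have hn := h.cast_pos
  have hα := h.alpha_pos
  have hC := h.C_nonneg
  have h1 := h.sum_approx hj
  have h2 := abs_cast_sub_le hj.le
  have h3 := abs_cast_sub_le_sq j n
  set M := powerSum a 1 j - powerSum a 1 n
  set d := (j : ℝ) - n
  set L := 2 * C + 3 * α with hL
  have h0 : 0 ≤ |d| := abs_nonneg d
  have h4 : |M - d| ≤ L * (|d| ^ 2 / n) := by
    have e1 : M - d = (M - d - α * d ^ 2 / (2 * n)) + α * d ^ 2 / (2 * n) := by ring
    have e2 : |α * d ^ 2 / (2 * n)| ≤ α * (|d| ^ 2 / n) := by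
      rw [abs_of_nonneg (by positivity), sq_abs, mul_div_assoc]
      gcongr
      linarith
    have e3 : |d| / n ≤ |d| ^ 2 / n := by gcongr
    have e4 : |d| ^ 3 / (n : ℝ) ^ 2 ≤ |d| ^ 2 / n := by
      rw [div_le_div_iff₀ (by positivity) hn]
      nlinarith [mul_le_mul_of_nonneg_left h2 (by positivity : (0 : ℝ) ≤ |d| ^ 2 * n)]
    have e5 : (C + α) * (|d| / n + |d| ^ 3 / (n : ℝ) ^ 2)
        ≤ (C + α) * (|d| ^ 2 / n + |d| ^ 2 / n) := by gcongr
    have e6 : (0 : ℝ) ≤ |d| ^ 2 / n := by positivity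
    rw [e1]
    refine (abs_add_le _ _).trans ?_
    have e7 : |M - d - α * d ^ 2 / (2 * n)| + |α * d ^ 2 / (2 * n)| ≤
      (C + α) * (|d| ^ 2 / n + |d| ^ 2 / n) + α * (|d| ^ 2 / n) := by linarith
    refine e7.trans (le_of_eq ?_)
    ring
  have h5 : |d| ^ 2 / n ≤ |d| := by
    rw [div_le_iff₀ hn]; nlinarith
  have h6 : |M + d| ≤ (L + 2) * |d| := by
    have e1 : M + d = (M - d) + 2 * d := by ring
    rw [e1]
    refine (abs_add_le _ _).trans ?_
    rw [abs_mul, abs_of_pos (by norm_num : (0 : ℝ) < 2)]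
    have : L * (|d| ^ 2 / n) ≤ L * |d| := by gcongr
    linarith
  rw [sq_sub_sq, abs_mul, mul_comm]
  calc |M - d| * |M + d| ≤ L * (|d| ^ 2 / n) * ((L + 2) * |d|) := by gcongr
    _ = _ := by ring

theorem mul_abs_sub_le (h : NearLinear a n α C c) {j : ℕ} (hj : j < 2 * n) :
    c / 3 * |(j : ℝ) - n| ≤ |powerSum a 1 j - powerSum a 1 n| := by
  have hc := h.c_pos
  have h2 := h.two_le
  have hm := powerSum_one_mono h.nonneg
  rcases le_total n j with hnj | hnj
  · have h1 := mul_le_powerSum_one_sub (a := a) (c := c) hnj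
      fun l hl hl' => h.c_le l (by omega) (by omega)
    have h3 : (0 : ℝ) ≤ (j : ℝ) - n := sub_nonneg.2 (Nat.cast_le.2 hnj)
    rw [abs_of_nonneg h3]
    refine le_trans ?_ (h1.trans (le_abs_self _))
    nlinarith [mul_nonneg hc.le h3]
  · set k := max j ((n + 1) / 2) with hk
    have h1 := mul_le_powerSum_one_sub (a := a) (c := c) (m := k) (k := n) (by omega)
      fun l hl hl' => h.c_le l (by omega) (by omega)
    have h3 := hm (by omega : j ≤ k)
    have h4 : (n : ℝ) - j ≤ 3 * (n - k) := by
      have : n + 3 * k ≤ 3 * n + j := by omega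
      have : (n : ℝ) + 3 * k ≤ 3 * n + j := by exact_mod_cast this
      linarith
    rw [abs_sub_comm, abs_of_nonneg (sub_nonneg.2 (Nat.cast_le.2 hnj)), abs_sub_comm]
    refine le_trans ?_ (le_abs_self _)
    nlinarith [mul_le_mul_of_nonneg_left h4 hc.le]

theorem powerSum_two_approx (h : NearLinear a n α C c) {j : ℕ} (hj : j ≤ 2 * n) :
    |powerSum a 2 j - powerSum a 2 n| ≤ C ^ 2 * |(j : ℝ) - n| := by
  refine abs_sub_le_of_abs_step_le fun l _ hl => ?_
  rw [powerSum_succ, add_sub_cancel_left, abs_of_nonneg (by positivity)]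
  exact pow_le_pow_left₀ (h.nonneg l) (h.le_C l (by omega)) 2

theorem powerSum_one_le (h : NearLinear a n α C c) {i : ℕ} (hi : i ≤ 2 * n) :
    |powerSum a 1 (2 * n) - powerSum a 1 i| ≤ 2 * C * n := by
  have hC := h.C_nonneg
  have h1 : |powerSum a 1 (2 * n) - powerSum a 1 i| ≤ C * |((2 * n : ℕ) : ℝ) - i| := by
    refine abs_sub_le_of_abs_step_le fun l _ hl => ?_
    rw [powerSum_succ, add_sub_cancel_left, pow_one, abs_of_nonneg (h.nonneg l)]
    exact h.le_C l (by omega)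
  have h2 : |((2 * n : ℕ) : ℝ) - i| ≤ 2 * n := by
    have : (i : ℝ) ≤ ((2 * n : ℕ) : ℝ) := Nat.cast_le.2 hi
    rw [abs_of_nonneg (by linarith)]
    push_cast
    linarith [i.cast_nonneg (α := ℝ)]
  nlinarith

end NearLinear


namespace NearLinear

variable {a : ℕ → ℝ} {e g : ℕ → ℕ → ℝ} {n : ℕ} {α C c : ℝ}

/-- The constant in the bound for the fourth moment of the truncated discrepancy. -/
noncomputable def momentConst (C c : ℝ) : ℝ := 240 * (C / (c / 3)) ^ 4

theorem momentConst_nonneg (C c : ℝ) : 0 ≤ momentConst C c := by unfold momentConst; positivity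

theorem redFirst_le (h : NearLinear a n α C c) (hf : IsFlux a e g) :
    redFirst g n (2 * n) ≤ momentConst C c / (n : ℝ) ^ 2 := by
  have hn := h.cast_pos
  have hc := h.c_pos
  have h2 := h.two_le
  have h1 := hf.redFirst_mul_le (by omega : 0 < n) (by omega : n ≤ 2 * n) h.nonneg h.le_C
  have h3 := mul_le_powerSum_one_sub (a := a) (c := c) (by omega : n ≤ 2 * n)
      fun l hl hl' => h.c_le l hl' (by omega)
  push_cast at h1 h3
  have h4 : (c / 3 * n) ^ 4 ≤ (powerSum a 1 (2 * n) - powerSum a 1 n) ^ 4 := by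
    refine pow_le_pow_left₀ (by positivity) ?_ 4
    nlinarith [mul_pos hc hn]
  have h5 := (mul_le_mul_of_nonneg_left h4 (hf.redFirst_nonneg n (2 * n))).trans h1
  rw [← le_div_iff₀ (by positivity)] at h5
  refine h5.trans (le_of_eq ?_)
  unfold momentConst
  field_simp
  ring

theorem sum_pow_four_le (h : NearLinear a n α C c) (hf : IsFlux a e g) :
    ∑ j ∈ Finset.range (2 * n), e (n - 1) j * |(j : ℝ) - n| ^ 4
      ≤ momentConst C c * (n : ℝ) ^ 2 := by
  have hn := h.cast_pos
  have hc := h.c_pos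
  have h2 := h.two_le
  have h1 := hf.exitMean_pow_four_le (by omega : 0 < n) (by omega : n ≤ 2 * n) h.nonneg h.le_C
  have h3 : (c / 3) ^ 4 * ∑ j ∈ Finset.range (2 * n), e (n - 1) j * |(j : ℝ) - n| ^ 4
      ≤ 60 * ((2 * n : ℕ) : ℝ) ^ 2 * C ^ 4 := by
    refine le_trans ?_ h1
    unfold exitMean
    rw [Finset.mul_sum]
    refine le_add_of_le_of_nonneg (Finset.sum_le_sum fun j hj => ?_)
      (Finset.sum_nonneg fun i _ => mul_nonneg (hf.g_nonneg _ _) (by positivity))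
    have h4 := h.mul_abs_sub_le (Finset.mem_range.1 hj)
    have h5 := pow_le_pow_left₀ (by positivity) h4 4
    rw [mul_left_comm, ← mul_pow]
    refine mul_le_mul_of_nonneg_left (h5.trans (le_of_eq ?_)) (hf.e_nonneg _ _)
    rw [← abs_pow, abs_of_nonneg (by positivity)]
  rw [← le_div_iff₀' (by positivity)] at h3
  refine h3.trans (le_of_eq ?_)
  unfold momentConst
  push_cast
  field_simp
  ring

theorem sum_weight_le_one (h : NearLinear a n α C c) (hf : IsFlux a e g) :
    ∑ j ∈ Finset.range (2 * n), e (n - 1) j ≤ 1 := by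
  have h2 := h.two_le
  have := hf.sum_add_redFirst (by omega : 0 < n) (by omega : 0 < 2 * n)
  linarith [hf.redFirst_nonneg n (2 * n)]

theorem sum_mul_le_of_mul_le (h : NearLinear a n α C c) (hf : IsFlux a e g) {φ : ℕ → ℝ} {s : ℝ}
    (hs : 0 < s) (hφ : ∀ j, φ j * s ≤ (n : ℝ) ^ 2 + |(j : ℝ) - n| ^ 4) :
    ∑ j ∈ Finset.range (2 * n), e (n - 1) j * φ j ≤ (1 + momentConst C c) * ((n : ℝ) ^ 2 / s) := by
  have h1 : (∑ j ∈ Finset.range (2 * n), e (n - 1) j * φ j) * s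
      ≤ (∑ j ∈ Finset.range (2 * n), e (n - 1) j) * (n : ℝ) ^ 2
        + ∑ j ∈ Finset.range (2 * n), e (n - 1) j * |(j : ℝ) - n| ^ 4 := by
    rw [Finset.sum_mul, Finset.sum_mul, ← Finset.sum_add_distrib]
    refine Finset.sum_le_sum fun j _ => ?_
    rw [mul_assoc, ← mul_add]
    exact mul_le_mul_of_nonneg_left (hφ j) (hf.e_nonneg _ _)
  have h2 := h.sum_weight_le_one hf
  have h3 := h.sum_pow_four_le hf
  rw [← mul_div_assoc, le_div_iff₀ hs]
  nlinarith [sq_nonneg (n : ℝ)]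

theorem sum_abs_le (h : NearLinear a n α C c) (hf : IsFlux a e g) :
    ∑ j ∈ Finset.range (2 * n), e (n - 1) j * |(j : ℝ) - n| ≤ (1 + momentConst C c) * √n := by
  have hn := h.cast_pos
  have hs := Real.sqrt_pos.2 hn
  have hss := Real.sq_sqrt hn.le
  set s := √(n : ℝ)
  refine (h.sum_mul_le_of_mul_le hf (pow_pos hs 3) fun j => ?_).trans (le_of_eq ?_)
  · rw [← hss]
    have h0 := abs_nonneg ((j : ℝ) - s ^ 2)
    set x := |(j : ℝ) - s ^ 2|
    rcases le_total x s with hx | hx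
    · have : x * s ^ 3 ≤ s * s ^ 3 := by gcongr
      nlinarith [pow_nonneg h0 4]
    · have : x * s ^ 3 ≤ x * x ^ 3 := by gcongr
      nlinarith [pow_pos hs 4]
  · rw [← hss]; field_simp

theorem sum_abs_pow_three_le (h : NearLinear a n α C c) (hf : IsFlux a e g) :
    ∑ j ∈ Finset.range (2 * n), e (n - 1) j * |(j : ℝ) - n| ^ 3
      ≤ (1 + momentConst C c) * (n * √n) := by
  have hn := h.cast_pos
  have hs := Real.sqrt_pos.2 hn
  have hss := Real.sq_sqrt hn.le
  set s := √(n : ℝ)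
  refine (h.sum_mul_le_of_mul_le hf hs fun j => ?_).trans (le_of_eq ?_)
  · rw [← hss]
    have h0 := abs_nonneg ((j : ℝ) - s ^ 2)
    set x := |(j : ℝ) - s ^ 2|
    rcases le_total x s with hx | hx
    · have : x ^ 3 * s ≤ s ^ 3 * s := by gcongr
      nlinarith [pow_nonneg h0 4]
    · have : x ^ 3 * s ≤ x ^ 3 * x := by gcongr
      nlinarith [pow_pos hs 4]
  · rw [← hss]; field_simp

theorem one_le_sqrt (h : NearLinear a n α C c) : 1 ≤ √(n : ℝ) := by
  have := h.two_le
  rw [Real.one_le_sqrt]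
  exact_mod_cast (by omega : 1 ≤ n)

theorem abs_sum_flux_le (h : NearLinear a n α C c) (hf : IsFlux a e g) {φ : ℕ → ℝ} {B : ℝ}
    (hφ : ∀ i < n, |φ i| ≤ B) :
    |∑ i ∈ Finset.range n, g i (2 * n - 1) * φ i| ≤ B * (momentConst C c / (n : ℝ) ^ 2) := by
  have hB : 0 ≤ B := (abs_nonneg _).trans (hφ 0 (by have := h.two_le; omega))
  refine (Finset.abs_sum_le_sum_abs _ _).trans ?_
  refine le_trans ?_ (mul_le_mul_of_nonneg_left (h.redFirst_le hf) hB)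
  unfold redFirst
  rw [Finset.mul_sum]
  refine Finset.sum_le_sum fun i hi => ?_
  rw [abs_mul, abs_of_nonneg (hf.g_nonneg _ _), mul_comm]
  exact mul_le_mul_of_nonneg_right (hφ i (Finset.mem_range.1 hi)) (hf.g_nonneg _ _)

theorem abs_sum_blue_le (hf : IsFlux a e g) {φ ψ : ℕ → ℝ} {m k : ℕ}
    (hφ : ∀ j < m, |φ j| ≤ ψ j) :
    |∑ j ∈ Finset.range m, e k j * φ j| ≤ ∑ j ∈ Finset.range m, e k j * ψ j := by
  refine (Finset.abs_sum_le_sum_abs _ _).trans (Finset.sum_le_sum fun j hj => ?_)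
  rw [abs_mul, abs_of_nonneg (hf.e_nonneg _ _)]
  exact mul_le_mul_of_nonneg_left (hφ j (Finset.mem_range.1 hj)) (hf.e_nonneg _ _)

theorem mean_add_le (h : NearLinear a n α C c) (hf : IsFlux a e g) :
    |∑ j ∈ Finset.range (2 * n), e (n - 1) j * ((j : ℝ) - n)
      + α / 2 * ((∑ j ∈ Finset.range (2 * n), e (n - 1) j * ((j : ℝ) - n) ^ 2) / n)|
      ≤ (2 * (C + α) * (1 + momentConst C c) + 2 * C * momentConst C c) / √n := by
  have hn := h.cast_pos
  have hα := h.alpha_pos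
  have hC := h.C_nonneg
  have hs := Real.sqrt_pos.2 hn
  have hs1 := h.one_le_sqrt
  have hss := Real.sq_sqrt hn.le
  have hm := momentConst_nonneg C c
  have h2 := h.two_le
  have h1 := abs_sum_blue_le (k := n - 1) hf fun j (hj : j < 2 * n) => h.sum_approx hj
  have h3 := h.abs_sum_flux_le hf (φ := fun i => powerSum a 1 (2 * n) - powerSum a 1 i)
    fun i hi => h.powerSum_one_le (by omega : i ≤ 2 * n)
  have h4 := hf.exitMean_one (by omega : 0 < n) (by omega : 0 < 2 * n)
  have h5 := h.sum_abs_le hf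
  have h6 := h.sum_abs_pow_three_le hf
  set s := √(n : ℝ)
  have h7 : ∑ j ∈ Finset.range (2 * n), e (n - 1) j *
      ((C + α) * (|(j : ℝ) - n| / n + |(j : ℝ) - n| ^ 3 / (n : ℝ) ^ 2))
      = (C + α) * ((∑ j ∈ Finset.range (2 * n), e (n - 1) j * |(j : ℝ) - n|) / n
        + (∑ j ∈ Finset.range (2 * n), e (n - 1) j * |(j : ℝ) - n| ^ 3) / (n : ℝ) ^ 2) := by
    rw [Finset.sum_div, Finset.sum_div, ← Finset.sum_add_distrib, Finset.mul_sum]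
    exact Finset.sum_congr rfl fun j _ => by ring
  have h8 : ∑ j ∈ Finset.range (2 * n), e (n - 1) j *
      (powerSum a 1 j - powerSum a 1 n - ((j : ℝ) - n) - α * ((j : ℝ) - n) ^ 2 / (2 * n))
      = ∑ j ∈ Finset.range (2 * n), e (n - 1) j * (powerSum a 1 j - powerSum a 1 n)
      - (∑ j ∈ Finset.range (2 * n), e (n - 1) j * ((j : ℝ) - n)
      + α / 2 * ((∑ j ∈ Finset.range (2 * n), e (n - 1) j * ((j : ℝ) - n) ^ 2) / n)) := by
    rw [Finset.sum_div, Finset.mul_sum, ← Finset.sum_add_distrib, ← Finset.sum_sub_distrib]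
    exact Finset.sum_congr rfl fun j _ => by ring
  rw [h7, h8] at h1
  unfold exitMean at h4
  have h9 : (C + α) * ((∑ j ∈ Finset.range (2 * n), e (n - 1) j * |(j : ℝ) - n|) / n
        + (∑ j ∈ Finset.range (2 * n), e (n - 1) j * |(j : ℝ) - n| ^ 3) / (n : ℝ) ^ 2)
      ≤ (C + α) * ((1 + momentConst C c) * s / n
        + (1 + momentConst C c) * (n * s) / (n : ℝ) ^ 2) := by gcongr
  have h10 : (C + α) * ((1 + momentConst C c) * s / n
        + (1 + momentConst C c) * (n * s) / (n : ℝ) ^ 2)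
      = 2 * (C + α) * (1 + momentConst C c) / s := by
    rw [← hss]; field_simp; ring
  have h11 : 2 * C * n * (momentConst C c / (n : ℝ) ^ 2) ≤ 2 * C * momentConst C c / s := by
    have : 2 * C * n * (momentConst C c / (n : ℝ) ^ 2) = 2 * C * momentConst C c / n := by
      field_simp
    rw [this]
    gcongr
    nlinarith
  rw [add_div]
  rw [abs_le] at h1 h3 ⊢
  constructor <;> linarith

theorem sq_sub_le (h : NearLinear a n α C c) (hf : IsFlux a e g) :
    |(∑ j ∈ Finset.range (2 * n), e (n - 1) j * ((j : ℝ) - n) ^ 2) / n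
      - 2 * (powerSum a 2 n / n)|
      ≤ (((2 * C + 3 * α) * (2 * C + 3 * α + 2) + C ^ 2) * (1 + momentConst C c)
        + 10 * C ^ 2 * momentConst C c) / √n := by
  have hn := h.cast_pos
  have hα := h.alpha_pos
  have hC := h.C_nonneg
  have hs := Real.sqrt_pos.2 hn
  have hs1 := h.one_le_sqrt
  have hss := Real.sq_sqrt hn.le
  have hm := momentConst_nonneg C c
  have h2 := h.two_le
  have h0 := hf.sum_add_redFirst (by omega : 0 < n) (by omega : 0 < 2 * n)
  have h1 := abs_sum_blue_le (k := n - 1) hf fun j (hj : j < 2 * n) => h.sum_sq_approx hj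
  have h1' := abs_sum_blue_le (k := n - 1) hf fun j (hj : j < 2 * n) =>
    h.powerSum_two_approx hj.le
  have hp2 : ∀ i ≤ 2 * n, 0 ≤ powerSum a 2 i ∧ powerSum a 2 i ≤ 2 * n * C ^ 2 := by
    intro i hi
    refine ⟨powerSum_nonneg 2 i fun l _ => h.nonneg l, (powerSum_two_le i (fun l _ => h.nonneg l)
      fun l hl => h.le_C l (by omega)).trans ?_⟩
    have : (i : ℝ) ≤ 2 * n := by exact_mod_cast hi
    gcongr
  have h3 := h.abs_sum_flux_le hf (B := 10 * C ^ 2 * n ^ 2)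
    (φ := fun i => (powerSum a 1 (2 * n) - powerSum a 1 i) ^ 2
      - (powerSum a 2 (2 * n) + powerSum a 2 i) + 2 * powerSum a 2 n) (by
    intro i hi
    have i1 := h.powerSum_one_le (by omega : i ≤ 2 * n)
    have i2 := pow_le_pow_left₀ (abs_nonneg _) i1 2
    rw [sq_abs] at i2
    obtain ⟨j1, j2⟩ := hp2 (2 * n) le_rfl
    obtain ⟨j3, j4⟩ := hp2 i (by omega)
    obtain ⟨j5, j6⟩ := hp2 n (by omega)
    have i3 := sq_nonneg (powerSum a 1 (2 * n) - powerSum a 1 i)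
    have i4 : (n : ℝ) * C ^ 2 ≤ n ^ 2 * C ^ 2 := by
      have : (1 : ℝ) ≤ n := by nlinarith
      have : (n : ℝ) ≤ n ^ 2 := by nlinarith
      gcongr
    rw [abs_le]
    constructor <;> nlinarith)
  have h4 := hf.exitMean_two (by omega : 0 < n) (by omega : 0 < 2 * n)
  have h5 := h.sum_abs_le hf
  have h6 := h.sum_abs_pow_three_le hf
  set s := √(n : ℝ)
  set L := (2 * C + 3 * α) * (2 * C + 3 * α + 2)
  have hL : 0 ≤ L := by positivity
  set T := ∑ j ∈ Finset.range (2 * n), e (n - 1) j * ((j : ℝ) - n) ^ 2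
  have h7 : ∑ j ∈ Finset.range (2 * n), e (n - 1) j * (L * (|(j : ℝ) - n| ^ 3 / n))
      = L * ((∑ j ∈ Finset.range (2 * n), e (n - 1) j * |(j : ℝ) - n| ^ 3) / n) := by
    rw [Finset.sum_div, Finset.mul_sum]
    exact Finset.sum_congr rfl fun j _ => by ring
  have h7' : ∑ j ∈ Finset.range (2 * n), e (n - 1) j * (C ^ 2 * |(j : ℝ) - n|)
      = C ^ 2 * ∑ j ∈ Finset.range (2 * n), e (n - 1) j * |(j : ℝ) - n| := by
    rw [Finset.mul_sum]
    exact Finset.sum_congr rfl fun j _ => by ring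
  rw [h7] at h1
  rw [h7'] at h1'
  have h8 : T - 2 * powerSum a 2 n =
      -(∑ j ∈ Finset.range (2 * n), e (n - 1) j *
          ((powerSum a 1 j - powerSum a 1 n) ^ 2 - ((j : ℝ) - n) ^ 2))
      + ∑ j ∈ Finset.range (2 * n), e (n - 1) j * (powerSum a 2 j - powerSum a 2 n)
      - ∑ i ∈ Finset.range n, g i (2 * n - 1) *
        ((powerSum a 1 (2 * n) - powerSum a 1 i) ^ 2
          - (powerSum a 2 (2 * n) + powerSum a 2 i) + 2 * powerSum a 2 n) := by
    unfold exitMean at h4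
    unfold redFirst at h0
    have : 2 * powerSum a 2 n = 2 * powerSum a 2 n * (∑ j ∈ Finset.range (2 * n), e (n - 1) j +
      ∑ i ∈ Finset.range n, g i (2 * n - 1)) := by rw [h0, mul_one]
    simp only [mul_add, mul_sub, Finset.sum_add_distrib, Finset.sum_sub_distrib,
      ← Finset.sum_mul] at h4 this ⊢
    linarith
  have h9 : L * ((∑ j ∈ Finset.range (2 * n), e (n - 1) j * |(j : ℝ) - n| ^ 3) / n)
      ≤ L * ((1 + momentConst C c) * (n * s) / n) := by gcongr
  have h9' : C ^ 2 * ∑ j ∈ Finset.range (2 * n), e (n - 1) j * |(j : ℝ) - n|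
      ≤ C ^ 2 * ((1 + momentConst C c) * s) := by gcongr
  have h10 : L * ((1 + momentConst C c) * (n * s) / n) = L * (1 + momentConst C c) * s := by
    field_simp
  have h11 : 10 * C ^ 2 * (n : ℝ) ^ 2 * (momentConst C c / (n : ℝ) ^ 2)
      ≤ 10 * C ^ 2 * momentConst C c * s := by
    have : 10 * C ^ 2 * (n : ℝ) ^ 2 * (momentConst C c / (n : ℝ) ^ 2)
      = 10 * C ^ 2 * momentConst C c * 1 := by field_simp
    rw [this]
    gcongr
  have h12 : |T - 2 * powerSum a 2 n| ≤
      ((L + C ^ 2) * (1 + momentConst C c) + 10 * C ^ 2 * momentConst C c) * s := by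
    rw [h8]
    rw [abs_le] at h1 h1' h3 ⊢
    constructor <;> linarith
  have h13 : T / n - 2 * (powerSum a 2 n / n) = (T - 2 * powerSum a 2 n) / n := by ring
  rw [h13, abs_div, abs_of_pos hn, div_le_div_iff₀ hn hs]
  refine (mul_le_mul_of_nonneg_right h12 hs.le).trans (le_of_eq ?_)
  rw [← hss]
  ring

end NearLinear


section Weights

variable {a : ℕ → ℝ} {e g : ℕ → ℕ → ℝ} {α C c : ℝ}

theorem redFirst_le_of_two_mul_le (h : ∀ n : ℕ, 2 ≤ n → NearLinear (fun l => ((n : ℝ) ^ α)⁻¹ * a l) n α C c)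
    (hf : IsFlux a e g) {n N : ℕ} (hn : 0 < n) (hN : 2 * n ≤ N) :
    redFirst g n N ≤ NearLinear.momentConst C c / (N : ℝ) ^ 2 := by
  have hN2 : 2 ≤ N := by omega
  have hNL := h N hN2
  have hN0 := hNL.cast_pos
  have hc := hNL.c_pos
  have h1 := (hf.const_mul ((N : ℝ) ^ α)⁻¹).redFirst_mul_le hn (by omega : n ≤ N) hNL.nonneg
    fun l hl => hNL.le_C l (by omega)
  set a' := fun l => ((N : ℝ) ^ α)⁻¹ * a l
  have h3 := mul_le_powerSum_one_sub (a := a') (c := c) (m := (N + 1) / 2) (k := N) (by omega)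
    fun l hl hl' => hNL.c_le l (by omega) (by omega)
  have h5 := powerSum_one_mono hNL.nonneg (by omega : n ≤ (N + 1) / 2)
  have h6 : (N : ℝ) ≤ 3 * (N - ((N + 1) / 2 : ℕ)) := by
    have : N + 3 * ((N + 1) / 2) ≤ 3 * N := by omega
    have : (N : ℝ) + 3 * ((N + 1) / 2 : ℕ) ≤ 3 * N := by exact_mod_cast this
    linarith
  have h4 : (c / 3 * N) ^ 4 ≤ (powerSum a' 1 N - powerSum a' 1 n) ^ 4 := by
    refine pow_le_pow_left₀ (by positivity) ?_ 4
    nlinarith [mul_le_mul_of_nonneg_left h6 hc.le]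
  have h7 := (mul_le_mul_of_nonneg_left h4 (hf.redFirst_nonneg n N)).trans h1
  rw [← le_div_iff₀ (by positivity)] at h7
  refine h7.trans ?_
  have : NearLinear.momentConst C c / (N : ℝ) ^ 2 = 4 * (60 * N ^ 2 * C ^ 4 / (c / 3 * N) ^ 4) := by
    unfold NearLinear.momentConst
    field_simp
    ring
  rw [this]
  have : 0 ≤ 60 * N ^ 2 * C ^ 4 / (c / 3 * N) ^ 4 := by positivity
  linarith

theorem IsFlux.redFirst_succ (hf : IsFlux a e g) {n N : ℕ} (hn : 0 < n) (hN : 0 < N) :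
    e (n - 1) N = redFirst g n N - redFirst g n (N + 1) := by
  have h1 := hf.sum_add_redFirst hn hN
  have h2 := hf.sum_add_redFirst hn N.succ_pos
  rw [Finset.sum_range_succ] at h2
  linarith

theorem hasSum_weight (h : ∀ n : ℕ, 2 ≤ n → NearLinear (fun l => ((n : ℝ) ^ α)⁻¹ * a l) n α C c)
    (hf : IsFlux a e g) {n : ℕ} (hn : 0 < n) : HasSum (fun j => e (n - 1) j) 1 := by
  rw [hasSum_iff_tendsto_nat_of_nonneg fun j => hf.e_nonneg _ _]
  have h1 : Tendsto (fun N : ℕ => NearLinear.momentConst C c / (N : ℝ) ^ 2) atTop (nhds 0) :=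
    tendsto_const_nhds.div_atTop
      ((tendsto_pow_atTop two_ne_zero).comp tendsto_natCast_atTop_atTop)
  have h2 : Tendsto (fun N => redFirst g n N) atTop (nhds 0) :=
    squeeze_zero' (Eventually.of_forall fun N => hf.redFirst_nonneg n N)
      ((eventually_ge_atTop (2 * n)).mono fun N hN => redFirst_le_of_two_mul_le h hf hn hN) h1
  have h3 : Tendsto (fun N => 1 - redFirst g n N) atTop (nhds (1 - 0)) :=
    tendsto_const_nhds.sub h2
  rw [sub_zero] at h3
  refine h3.congr' ((eventually_gt_atTop 0).mono fun N hN => ?_)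
  linarith [hf.sum_add_redFirst hn hN]

theorem sum_tail_le (h : ∀ n : ℕ, 2 ≤ n → NearLinear (fun l => ((n : ℝ) ^ α)⁻¹ * a l) n α C c)
    (hf : IsFlux a e g) {n : ℕ} (hn : 0 < n) (k : ℕ) :
    ∑ j ∈ Finset.range k, e (n - 1) (j + 2 * n) * (((j + 2 * n : ℕ) : ℝ) - n)
      ≤ NearLinear.momentConst C c / n := by
  set K := NearLinear.momentConst C c
  have hK : 0 ≤ K := NearLinear.momentConst_nonneg C c
  have hn0 : (0 : ℝ) < n := by exact_mod_cast hn
  have key : ∑ j ∈ Finset.range k, e (n - 1) (j + 2 * n) * (((j + 2 * n : ℕ) : ℝ) - n)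
      + redFirst g n (k + 2 * n) * (((k + 2 * n : ℕ) : ℝ) - n)
      ≤ K / n - K / ((k + 2 * n : ℕ) : ℝ) := by
    induction k with
    | zero =>
      have := redFirst_le_of_two_mul_le h hf hn le_rfl
      push_cast at this ⊢
      simp only [Finset.range_zero, Finset.sum_empty, zero_add]
      have h1 : redFirst g n (2 * n) * (2 * (n : ℝ) - n) ≤ K / (2 * n) ^ 2 * n := by
        rw [show 2 * (n : ℝ) - n = n by ring]
        gcongr
      refine h1.trans ?_
      have : K / n - K / (2 * n) - K / (2 * n) ^ 2 * n = K / (4 * n) := by field_simp; ring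
      have : 0 ≤ K / (4 * n) := by positivity
      linarith
    | succ k ih =>
      rw [Finset.sum_range_succ, hf.redFirst_succ hn (by omega : 0 < k + 2 * n)]
      have h1 := redFirst_le_of_two_mul_le h hf hn (by omega : 2 * n ≤ k + 2 * n + 1)
      rw [show k + 1 + 2 * n = k + 2 * n + 1 by ring]
      have hx : (0 : ℝ) < ((k + 2 * n : ℕ) : ℝ) := by exact_mod_cast (by omega : 0 < k + 2 * n)
      set m := k + 2 * n
      rw [Nat.cast_succ] at h1 ⊢
      have h2 : K / ((m : ℝ) + 1) ^ 2 ≤ K / m - K / ((m : ℝ) + 1) := by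
        have : K / m - K / ((m : ℝ) + 1) - K / ((m : ℝ) + 1) ^ 2 = K / (m * ((m : ℝ) + 1) ^ 2) := by
          field_simp; ring
        have : 0 ≤ K / (m * ((m : ℝ) + 1) ^ 2) := by positivity
        linarith
      nlinarith
  have h1 : 0 ≤ redFirst g n (k + 2 * n) * (((k + 2 * n : ℕ) : ℝ) - n) := by
    refine mul_nonneg (hf.redFirst_nonneg _ _) ?_
    push_cast
    linarith [k.cast_nonneg (α := ℝ)]
  have h2 : 0 ≤ K / ((k + 2 * n : ℕ) : ℝ) := by positivity
  linarith

theorem tail_nonneg (hf : IsFlux a e g) (n j : ℕ) :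
    0 ≤ e (n - 1) (j + 2 * n) * (((j + 2 * n : ℕ) : ℝ) - n) := by
  refine mul_nonneg (hf.e_nonneg _ _) ?_
  push_cast
  linarith [j.cast_nonneg (α := ℝ), n.cast_nonneg (α := ℝ)]

theorem summable_mean (h : ∀ n : ℕ, 2 ≤ n → NearLinear (fun l => ((n : ℝ) ^ α)⁻¹ * a l) n α C c)
    (hf : IsFlux a e g) {n : ℕ} (hn : 0 < n) : Summable fun j => e (n - 1) j * ((j : ℝ) - n) := by
  rw [← summable_nat_add_iff (2 * n)]
  exact summable_of_sum_range_le (tail_nonneg hf n) (sum_tail_le h hf hn)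

theorem abs_tsum_sub_le (h : ∀ n : ℕ, 2 ≤ n → NearLinear (fun l => ((n : ℝ) ^ α)⁻¹ * a l) n α C c)
    (hf : IsFlux a e g) {n : ℕ} (hn : 0 < n) :
    |∑' j, e (n - 1) j * ((j : ℝ) - n)
      - ∑ j ∈ Finset.range (2 * n), e (n - 1) j * ((j : ℝ) - n)|
      ≤ NearLinear.momentConst C c / n := by
  rw [← (summable_mean h hf hn).sum_add_tsum_nat_add (2 * n), add_sub_cancel_left,
    abs_of_nonneg (tsum_nonneg (tail_nonneg hf n))]
  exact Real.tsum_le_of_sum_range_le (tail_nonneg hf n) (sum_tail_le h hf hn)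

theorem tendsto_tsum_mean (h : ∀ n : ℕ, 2 ≤ n → NearLinear (fun l => ((n : ℝ) ^ α)⁻¹ * a l) n α C c)
    (hf : IsFlux a e g)
    (h2 : Tendsto (fun n : ℕ => powerSum (fun l => ((n : ℝ) ^ α)⁻¹ * a l) 2 n / n) atTop
      (nhds (1 / (2 * α + 1)))) :
    Tendsto (fun n : ℕ => ∑' j, e (n - 1) j * ((j : ℝ) - n)) atTop (nhds (-α / (2 * α + 1))) := by
  have hs : Tendsto (fun n : ℕ => √(n : ℝ)) atTop atTop :=
    Real.tendsto_sqrt_atTop.comp tendsto_natCast_atTop_atTop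
  have hK : ∀ K : ℝ, Tendsto (fun n : ℕ => K / √(n : ℝ)) atTop (nhds 0) := fun K =>
    tendsto_const_nhds.div_atTop hs
  have hge := eventually_ge_atTop 2
  have t1 := squeeze_zero_norm' (hge.mono fun n hn =>
    (Real.norm_eq_abs _).trans_le (abs_tsum_sub_le h hf (by omega : 0 < n))) (tendsto_const_nhds.div_atTop
      tendsto_natCast_atTop_atTop)
  have t2 := squeeze_zero_norm' (hge.mono fun n hn =>
    (Real.norm_eq_abs _).trans_le ((h n hn).mean_add_le (hf.const_mul _))) (hK _)
  have t3 := squeeze_zero_norm' (hge.mono fun n hn =>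
    (Real.norm_eq_abs _).trans_le ((h n hn).sq_sub_le (hf.const_mul _))) (hK _)
  have t4 := ((t1.add t2).sub (t3.const_mul (α / 2))).sub (h2.const_mul α)
  have e1 : (0 : ℝ) + 0 - α / 2 * 0 - α * (1 / (2 * α + 1)) = -α / (2 * α + 1) := by ring
  rw [e1] at t4
  refine t4.congr fun n => ?_
  ring

/-! ### Power-law weights -/

theorem exists_abs_rpow_sub_le (α : ℝ) (hα : 0 < α) :
    ∃ C, 0 ≤ C ∧ ∀ x : ℝ, 1 / 2 ≤ x → x ≤ 2 →
      |x ^ α - 1 - α * (x - 1)| ≤ C * (x - 1) ^ 2 := by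
  have hpos : ∀ x ∈ Set.Icc (1 / 2 : ℝ) 2, x ≠ 0 := fun x hx => by linarith [hx.1]
  have hone : (1 : ℝ) ∈ Set.Icc (1 / 2 : ℝ) 2 := by norm_num
  obtain ⟨C, hC⟩ := isCompact_Icc.exists_bound_of_continuousOn
    (f := fun x : ℝ => (α - 1) * x ^ (α - 1 - 1)) (s := Set.Icc (1 / 2 : ℝ) 2)
    (continuousOn_const.mul fun x hx =>
      (Real.continuousAt_rpow_const x _ (Or.inl (hpos x hx))).continuousWithinAt)
  have hC0 : 0 ≤ C := (norm_nonneg _).trans (hC 1 hone)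
  refine ⟨α * C, by positivity, fun x hx1 hx2 => ?_⟩
  have h1 : ∀ y ∈ Set.Icc (1 / 2 : ℝ) 2, |y ^ (α - 1) - 1| ≤ C * |y - 1| := by
    intro y hy
    have := (convex_Icc (1 / 2 : ℝ) 2).norm_image_sub_le_of_norm_hasDerivWithin_le
      (f := fun x : ℝ => x ^ (α - 1)) (f' := fun x => (α - 1) * x ^ (α - 1 - 1)) (C := C)
      (fun x hx => (Real.hasDerivAt_rpow_const (Or.inl (hpos x hx))).hasDerivWithinAt) hC hone hy
    simpa using this
  have hsub : Set.uIcc 1 x ⊆ Set.Icc (1 / 2 : ℝ) 2 := Set.uIcc_subset_Icc hone ⟨hx1, hx2⟩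
  have h2 := (convex_uIcc 1 x).norm_image_sub_le_of_norm_hasDerivWithin_le
      (f := fun x : ℝ => x ^ α - α * x) (f' := fun x => α * x ^ (α - 1) - α)
      (C := α * (C * |x - 1|))
      (fun y hy => ((Real.hasDerivAt_rpow_const (Or.inl (hpos y (hsub hy)))).sub
        (by simpa using (hasDerivAt_id y).const_mul α)).hasDerivWithinAt) (fun y hy => by
        rw [← mul_sub_one, norm_mul, Real.norm_of_nonneg hα.le]
        refine mul_le_mul_of_nonneg_left ((h1 y (hsub hy)).trans ?_) hα.le
        exact mul_le_mul_of_nonneg_left (Set.abs_sub_left_of_mem_uIcc hy) hC0)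
      Set.left_mem_uIcc Set.right_mem_uIcc
  simp only [Real.one_rpow, mul_one, Real.norm_eq_abs] at h2
  calc |x ^ α - 1 - α * (x - 1)| = |x ^ α - α * x - (1 - α)| := by congr 1; ring
    _ ≤ _ := h2
    _ = α * C * |x - 1| ^ 2 := by ring
    _ = _ := by rw [sq_abs]

end Weights


section PowerLaw

variable {b : ℕ → ℝ} {α : ℝ}

theorem exists_pos_forall_le_of_eventually {f : ℕ → ℝ} {K : ℝ} (h : ∀ᶠ n in atTop, f n ≤ K) :
    ∃ K', 0 < K' ∧ ∀ n, f n ≤ K' := by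
  obtain ⟨K', hK'⟩ := (isBoundedUnder_of_eventually_le h).bddAbove_range
  exact ⟨max K' 1, by positivity, fun n => (hK' ⟨n, rfl⟩).trans (le_max_left _ _)⟩

/-- `b` is positive and `b l = l ^ α (1 + O(1 / l))`. -/
structure PowerLaw (b : ℕ → ℝ) (α : ℝ) : Prop where
  alpha_pos : 0 < α
  pos : ∀ l, 0 < b l
  approx : ∃ C : ℝ, ∀ᶠ l : ℕ in atTop, |b l - (l : ℝ) ^ α| ≤ C * ((l : ℝ) ^ α / l)

namespace PowerLaw

theorem exists_abs_sub_le (h : PowerLaw b α) :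
    ∃ C, 0 < C ∧ ∀ l : ℕ, 0 < l → |b l - (l : ℝ) ^ α| ≤ C * ((l : ℝ) ^ α / l) := by
  obtain ⟨C, hC⟩ := h.approx
  obtain ⟨K, hK0, hK⟩ := exists_pos_forall_le_of_eventually
    (f := fun l : ℕ => |b l - (l : ℝ) ^ α| / ((l : ℝ) ^ α / l)) (K := C) (by
      filter_upwards [hC, eventually_gt_atTop 0] with l hl hl0
      have : (0 : ℝ) < l := by exact_mod_cast hl0
      rwa [div_le_iff₀ (by positivity)])
  refine ⟨K, hK0, fun l hl => ?_⟩
  have : (0 : ℝ) < l := by exact_mod_cast hl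
  rw [← div_le_iff₀ (by positivity)]
  exact hK l

theorem tendsto_div (h : PowerLaw b α) :
    Tendsto (fun l : ℕ => b l / (l : ℝ) ^ α) atTop (nhds 1) := by
  obtain ⟨C, hC⟩ := h.approx
  have h1 : Tendsto (fun l : ℕ => b l / (l : ℝ) ^ α - 1) atTop (nhds 0) := by
    refine squeeze_zero_norm' (a := fun l : ℕ => C / (l : ℝ)) ?_
      (tendsto_const_nhds.div_atTop tendsto_natCast_atTop_atTop)
    filter_upwards [hC, eventually_gt_atTop 0] with l hl hl0
    have hl1 : (0 : ℝ) < l := by exact_mod_cast hl0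
    have hl2 : (0 : ℝ) < (l : ℝ) ^ α := by positivity
    rw [div_sub_one hl2.ne', Real.norm_eq_abs, abs_div, abs_of_pos hl2, div_le_iff₀ hl2]
    refine hl.trans (le_of_eq ?_)
    ring
  simpa using h1.add_const 1

theorem exists_mul_le (h : PowerLaw b α) :
    ∃ c, 0 < c ∧ ∀ l : ℕ, c * (l : ℝ) ^ α ≤ b l := by
  have h1 := h.tendsto_div.inv₀ one_ne_zero
  obtain ⟨K, hK0, hK⟩ := exists_pos_forall_le_of_eventually (f := fun l => (b l / (l : ℝ) ^ α)⁻¹)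
    (K := 2) ((h1.eventually_lt_const (by norm_num)).mono fun _ hl => hl.le)
  refine ⟨K⁻¹, by positivity, fun l => ?_⟩
  have := hK l
  simp only [inv_div] at this
  rw [div_le_iff₀ (h.pos l)] at this
  rwa [inv_mul_le_iff₀ hK0]

theorem exists_nearLinear (h : PowerLaw b α) :
    ∃ C c, ∀ n : ℕ, 2 ≤ n → NearLinear (fun l => ((n : ℝ) ^ α)⁻¹ * b l) n α C c := by
  have hα := h.alpha_pos
  obtain ⟨C₁, hC₁, h₁⟩ := h.exists_abs_sub_le
  obtain ⟨c₀, hc₀, h₂⟩ := h.exists_mul_le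
  obtain ⟨C₂, hC₂, h₃⟩ := exists_abs_rpow_sub_le α hα
  set A := b 0 + (1 + C₁) * 2 ^ α with hA
  have hb0 := h.pos 0
  have hA0 : 0 < A := by positivity
  have hle : ∀ n : ℕ, 2 ≤ n → ∀ l < 2 * n, ((n : ℝ) ^ α)⁻¹ * b l ≤ A := by
    intro n hn l hl
    have hn1 : (1 : ℝ) ≤ n := by exact_mod_cast (by omega : 1 ≤ n)
    have hn0 : (0 : ℝ) < (n : ℝ) ^ α := by positivity
    have hn2 : 1 ≤ (n : ℝ) ^ α := Real.one_le_rpow hn1 hα.le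
    rw [inv_mul_le_iff₀ hn0]
    rcases Nat.eq_zero_or_pos l with rfl | hl0
    · have : (0 : ℝ) ≤ (1 + C₁) * 2 ^ α := by positivity
      nlinarith
    · have e1 := (abs_le.1 (h₁ l hl0)).2
      have hl1 : (1 : ℝ) ≤ l := by exact_mod_cast hl0
      have e2 : (l : ℝ) ^ α / l ≤ (l : ℝ) ^ α := div_le_self (by positivity) hl1
      have e3 : (l : ℝ) ^ α ≤ 2 ^ α * (n : ℝ) ^ α := by
        rw [← Real.mul_rpow (by norm_num) (by positivity)]
        refine Real.rpow_le_rpow (by positivity) ?_ hα.le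
        exact_mod_cast hl.le
      have e4 : b l ≤ (1 + C₁) * (2 ^ α * (n : ℝ) ^ α) := by
        calc b l ≤ (1 + C₁) * (l : ℝ) ^ α := by nlinarith
          _ ≤ _ := by gcongr
      have e5 : 0 ≤ b 0 * (n : ℝ) ^ α := by positivity
      rw [hA]
      linarith
  refine ⟨A + (C₂ + C₁ * 2 ^ α * 2) + 4 * (A + 1 + α), c₀ / 2 ^ α, fun n hn => ?_⟩
  have hn1 : (1 : ℝ) ≤ n := by exact_mod_cast (by omega : 1 ≤ n)
  have hn0 : (0 : ℝ) < (n : ℝ) ^ α := by positivity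
  have hn3 : (0 : ℝ) < n := by linarith
  refine ⟨hn, hα, by positivity, fun l => ?_, fun l hl => ?_, fun l _ hnl => ?_, fun l hl => ?_⟩
  · have := h.pos l
    positivity
  · refine (hle n hn l hl).trans ?_
    have : 0 ≤ (C₂ + C₁ * 2 ^ α * 2) + 4 * (A + 1 + α) := by positivity
    linarith
  · rw [le_inv_mul_iff₀ hn0]
    refine le_trans ?_ (h₂ l)
    have : (n : ℝ) ^ α ≤ 2 ^ α * (l : ℝ) ^ α := by
      rw [← Real.mul_rpow (by norm_num) (by positivity)]
      refine Real.rpow_le_rpow (by positivity) ?_ hα.le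
      exact_mod_cast hnl
    calc (n : ℝ) ^ α * (c₀ / 2 ^ α) ≤ 2 ^ α * (l : ℝ) ^ α * (c₀ / 2 ^ α) := by gcongr
      _ = _ := by field_simp
  · set x : ℝ := (l : ℝ) / n with hx
    have hl2 : (l : ℝ) ≤ 2 * n := by exact_mod_cast hl.le
    have hx0 : 0 ≤ x := by positivity
    have hx2 : x ≤ 2 := by rw [hx, div_le_iff₀ hn3]; exact hl2
    have hxs : ((l : ℝ) - n) ^ 2 / (n : ℝ) ^ 2 = (x - 1) ^ 2 := by rw [hx]; field_simp
    have hxa : α * ((l : ℝ) - n) / n = α * (x - 1) := by rw [hx]; field_simp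
    rw [hxs, hxa]
    have hi : (0 : ℝ) ≤ 1 / n := by positivity
    rcases le_or_gt (1 / 2) x with hxl | hxl
    · have hl0 : 0 < l := by
        rcases Nat.eq_zero_or_pos l with rfl | h0
        · rw [hx] at hxl; norm_num at hxl
        · exact h0
      have hl0' : (0 : ℝ) < l := by exact_mod_cast hl0
      have hxx : x ^ α = ((n : ℝ) ^ α)⁻¹ * (l : ℝ) ^ α := by
        rw [hx, Real.div_rpow (by positivity) (by positivity), div_eq_inv_mul]
      have e1 : |((n : ℝ) ^ α)⁻¹ * b l - x ^ α| ≤ C₁ * 2 ^ α * 2 * (1 / n) := by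
        rw [hxx, ← mul_sub, abs_mul, abs_of_pos (by positivity)]
        have hln : 1 / (l : ℝ) ≤ 2 * (1 / n) := by
          rw [hx, div_le_div_iff₀ (by norm_num) hn3] at hxl
          rw [← mul_div_assoc, div_le_div_iff₀ hl0' hn3]
          linarith
        calc ((n : ℝ) ^ α)⁻¹ * |b l - (l : ℝ) ^ α|
            ≤ ((n : ℝ) ^ α)⁻¹ * (C₁ * ((l : ℝ) ^ α / l)) := by
              gcongr
              exact h₁ l hl0
          _ = C₁ * x ^ α * (1 / l) := by rw [hxx]; ring
          _ ≤ C₁ * 2 ^ α * (2 * (1 / n)) := by gcongr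
          _ = _ := by ring
      have e2 := h₃ x hxl hx2
      have e3 := abs_sub_le (((n : ℝ) ^ α)⁻¹ * b l) (x ^ α) (1 + α * (x - 1))
      rw [← sub_sub, ← sub_sub] at e3
      have e4 : 0 ≤ (A + 4 * (A + 1 + α) + C₂) * (1 / n) := by positivity
      have e5 : 0 ≤ (A + C₁ * 2 ^ α * 2 + 4 * (A + 1 + α)) * (x - 1) ^ 2 := by positivity
      nlinarith
    · have e1 := hle n hn l hl
      have e2 : 0 ≤ ((n : ℝ) ^ α)⁻¹ * b l := by have := h.pos l; positivity
      have e3 : 1 / 4 ≤ (x - 1) ^ 2 := by nlinarith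
      have e4 : |((n : ℝ) ^ α)⁻¹ * b l - 1 - α * (x - 1)| ≤ A + 1 + α := by
        rw [abs_le]
        constructor <;> nlinarith
      have e5 : A + 1 + α ≤ 4 * (A + 1 + α) * (x - 1) ^ 2 := by nlinarith
      have e6 : 0 ≤ (A + (C₂ + C₁ * 2 ^ α * 2) + 4 * (A + 1 + α)) * (1 / n) := by positivity
      have e7 : 0 ≤ (A + (C₂ + C₁ * 2 ^ α * 2)) * (x - 1) ^ 2 := by positivity
      nlinarith

theorem tendsto_rpow_succ_sub (s : ℝ) :
    Tendsto (fun l : ℕ => (((l + 1 : ℕ) : ℝ) ^ s - (l : ℝ) ^ s) / (l : ℝ) ^ (s - 1))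
      atTop (nhds s) := by
  have h1 : HasDerivAt (fun x : ℝ => x ^ s) (s * 1 ^ (s - 1)) 1 :=
    Real.hasDerivAt_rpow_const (Or.inl one_ne_zero)
  rw [Real.one_rpow, mul_one] at h1
  have h2 : Tendsto (fun l : ℕ => (l : ℝ)⁻¹) atTop (nhdsWithin 0 {0}ᶜ) := by
    refine tendsto_nhdsWithin_iff.2 ⟨tendsto_inv_atTop_zero.comp tendsto_natCast_atTop_atTop, ?_⟩
    filter_upwards [eventually_gt_atTop 0] with l hl
    have : (0 : ℝ) < l := by exact_mod_cast hl
    simp [this.ne']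
  refine (h1.tendsto_slope_zero.comp h2).congr' ?_
  filter_upwards [eventually_gt_atTop 0] with l hl
  have hl0 : (0 : ℝ) < l := by exact_mod_cast hl
  have e1 : 1 + (l : ℝ)⁻¹ = ((l + 1 : ℕ) : ℝ) / l := by push_cast; field_simp
  simp only [Function.comp_apply, inv_inv, smul_eq_mul, Real.one_rpow]
  rw [e1, Real.div_rpow (by positivity) hl0.le, Real.rpow_sub_one hl0.ne']
  field_simp

theorem tendsto_powerSum_two (h : PowerLaw b α) :
    Tendsto (fun n : ℕ => powerSum (fun l => ((n : ℝ) ^ α)⁻¹ * b l) 2 n / n) atTop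
      (nhds (1 / (2 * α + 1))) := by
  have hα := h.alpha_pos
  set s := 2 * α + 1 with hs
  have hs0 : 0 < s := by positivity
  set γ : ℕ → ℝ := fun l => ((l + 1 : ℕ) : ℝ) ^ s - (l : ℝ) ^ s with hγ
  have hγ0 : ∀ l, 0 < γ l := fun l => sub_pos.2
    (Real.rpow_lt_rpow (by positivity) (by exact_mod_cast Nat.lt_succ_self l) hs0)
  have hsum : ∀ n, ∑ l ∈ Finset.range n, γ l = (n : ℝ) ^ s := by
    intro n
    rw [Finset.sum_range_sub (fun l : ℕ => (l : ℝ) ^ s)]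
    simp [Real.zero_rpow hs0.ne']
  have h1 : Tendsto (fun l => b l ^ 2 / γ l) atTop (nhds (1 / s)) := by
    have := (h.tendsto_div.pow 2).div (tendsto_rpow_succ_sub s) hs0.ne'
    rw [one_pow] at this
    refine this.congr' ?_
    filter_upwards [eventually_gt_atTop 0] with l hl
    have hl0 : (0 : ℝ) < l := by exact_mod_cast hl
    have e1 : (l : ℝ) ^ (s - 1) = ((l : ℝ) ^ α) ^ 2 := by
      rw [← Real.rpow_natCast, ← Real.rpow_mul hl0.le, hs]
      congr 1
      push_cast
      ring
    have e2 : (l : ℝ) ^ α ≠ 0 := by positivity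
    have e3 := (hγ0 l).ne'
    simp only [Pi.div_apply]
    rw [e1]
    change (b l / (l : ℝ) ^ α) ^ 2 / (γ l / ((l : ℝ) ^ α) ^ 2) = _
    field_simp
  have h2 : (fun l => b l ^ 2 - 1 / s * γ l) =o[atTop] γ := by
    rw [Asymptotics.isLittleO_iff_tendsto fun l hl => absurd hl (hγ0 l).ne']
    have := h1.sub_const (1 / s)
    rw [sub_self] at this
    refine this.congr fun l => ?_
    have e3 := (hγ0 l).ne'
    field_simp
  have h3 := h2.sum_range (fun l => (hγ0 l).le) (by
    simp only [hsum]
    exact (tendsto_rpow_atTop hs0).comp tendsto_natCast_atTop_atTop)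
  have h4 := h3.tendsto_div_nhds_zero.add_const (1 / s)
  rw [zero_add] at h4
  refine h4.congr' ?_
  filter_upwards [eventually_gt_atTop 0] with n hn
  have hn0 : (0 : ℝ) < n := by exact_mod_cast hn
  have e0 : (0 : ℝ) < (n : ℝ) ^ α := by positivity
  have e1 : (n : ℝ) ^ s = ((n : ℝ) ^ α) ^ 2 * n := by
    rw [← Real.rpow_natCast, ← Real.rpow_mul hn0.le, hs, Real.rpow_add_one hn0.ne']
    congr 2
    push_cast
    ring
  rw [Finset.sum_sub_distrib, ← Finset.mul_sum, hsum]
  unfold powerSum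
  simp only [mul_pow, ← Finset.mul_sum]
  rw [e1]
  field_simp
  ring

theorem tendsto_tsum_mean {e g : ℕ → ℕ → ℝ} (h : PowerLaw b α) (hf : IsFlux b e g) :
    Tendsto (fun n : ℕ => ∑' j, e (n - 1) j * ((j : ℝ) - n)) atTop (nhds (-α / (2 * α + 1))) := by
  obtain ⟨C, c, hC⟩ := h.exists_nearLinear
  exact _root_.tendsto_tsum_mean hC hf h.tendsto_powerSum_two

theorem of_weightAsymp {w : ℕ → ℝ} {B : ℝ} (hα : 0 < α) (hw : ∀ n, 0 < w n)
    (h : WeightAsymp w α B) : PowerLaw (fun l => (2 ^ α : ℝ)⁻¹ * (1 / w (2 * l))) α := by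
  refine ⟨hα, fun l => by have := hw (2 * l); positivity, ?_⟩
  obtain ⟨C₀, hC₀, N₀, h⟩ := h
  refine ⟨2 * |B| + C₀, ?_⟩
  filter_upwards [eventually_ge_atTop (max N₀ 1)] with l hl
  have hl1 : (1 : ℝ) ≤ l := by exact_mod_cast (le_max_right _ _).trans hl
  have hl0 : (0 : ℝ) < 2 * l := by linarith
  have h1 := h (2 * l) (by have := (le_max_left _ _).trans hl; omega)
  push_cast at h1
  set t : ℝ := 2 * l
  have e1 : t ^ (α - 1) = t ^ α / t := Real.rpow_sub_one hl0.ne' _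
  have e2 : t ^ (α - 2) ≤ t ^ α / t := by
    rw [← e1]
    exact Real.rpow_le_rpow_of_exponent_le (by linarith) (by linarith)
  have e3 : t ^ α = 2 ^ α * (l : ℝ) ^ α := Real.mul_rpow (by norm_num) (by linarith)
  have e4 : t ^ α / t ≤ t ^ α / l := by
    gcongr
    linarith
  rw [e1] at h1
  have h2 : |1 / w (2 * l) - t ^ α| ≤ (2 * |B| + C₀) * (t ^ α / l) := by
    have e5 := abs_add_le (1 / w (2 * l) - t ^ α - 2 * B * (t ^ α / t)) (2 * B * (t ^ α / t))
    rw [sub_add_cancel] at e5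
    have e6 : |2 * B * (t ^ α / t)| = 2 * |B| * (t ^ α / t) := by
      rw [abs_mul, abs_mul, abs_two, abs_of_nonneg (by positivity : 0 ≤ t ^ α / t)]
    have e7 : 2 * |B| * (t ^ α / t) ≤ 2 * |B| * (t ^ α / l) := by gcongr
    have e8 : C₀ * t ^ (α - 2) ≤ C₀ * (t ^ α / l) := by
      gcongr
      exact e2.trans e4
    linarith
  have e9 : (2 ^ α : ℝ)⁻¹ * (1 / w (2 * l)) - (l : ℝ) ^ α
      = (2 ^ α : ℝ)⁻¹ * (1 / w (2 * l) - t ^ α) := by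
    rw [e3]
    field_simp
  rw [e9, abs_mul, abs_of_pos (by positivity), inv_mul_le_iff₀ (by positivity)]
  refine h2.trans (le_of_eq ?_)
  rw [e3]
  ring

end PowerLaw

end PowerLaw


namespace Urn

section Path

variable {Ω : Type*} [MeasurableSpace Ω] {μ : Measure Ω} {b r : ℕ → ℝ}

theorem Bl_add_Re (U : Urn μ b r) (n : ℕ) (ω : Ω) : U.Bl n ω + U.Re n ω = n := by
  induction n with
  | zero => rw [U.init_Bl, U.init_Re]
  | succ n ih => rcases U.step n ω with h | h <;> omega

theorem Bl_succ (U : Urn μ b r) (n : ℕ) (ω : Ω) :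
    U.Bl (n + 1) ω = U.Bl n ω + 1 ∨ U.Bl (n + 1) ω = U.Bl n ω := by
  rcases U.step n ω with h | h
  · exact Or.inl h.1
  · exact Or.inr h.1

theorem Bl_mono (U : Urn μ b r) (ω : Ω) : Monotone fun n => U.Bl n ω :=
  monotone_nat_of_le_succ fun n => by rcases U.Bl_succ n ω with h | h <;> omega

/-- If the `m`-th draw is the `k`-th blue ball, then `τ_k = m`. -/
theorem tau_succ_eq (U : Urn μ b r) {ω : Ω} {k m : ℕ} (h₁ : U.Bl m ω = k)
    (h₂ : U.Bl (m + 1) ω = k + 1) : U.tau (k + 1) ω = m + 1 := by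
  have key : ∀ p : ℕ, U.tau k ω = p → p ≤ m → U.Bl p ω = k → U.tau (k + 1) ω = m + 1 := by
    intro p hp hpm hpk
    have hmem : m + 1 ∈ {n : ℕ | U.tau k ω < n ∧ U.Bl n ω = U.Bl (n - 1) ω + 1} :=
      ⟨by omega, by rw [Nat.add_sub_cancel, h₁, h₂]⟩
    refine le_antisymm (Nat.sInf_le hmem) (le_csInf ⟨_, hmem⟩ fun n hn => ?_)
    obtain ⟨hn1, hn2⟩ := hn
    by_contra hlt
    have i1 := U.Bl_mono ω (by omega : p ≤ n - 1)
    have i2 := U.Bl_mono ω (by omega : n ≤ m)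
    simp only at i1 i2
    omega
  induction k generalizing m with
  | zero => exact key 0 rfl (Nat.zero_le _) (U.init_Bl ω)
  | succ k ih =>
    have hex : ∃ p, k + 1 ≤ U.Bl p ω := ⟨m, h₁.ge⟩
    obtain ⟨q, hq⟩ : ∃ q, Nat.find hex = q + 1 := by
      refine Nat.exists_eq_succ_of_ne_zero fun h0 => ?_
      have := Nat.find_spec hex
      rw [h0, U.init_Bl] at this
      omega
    have i1 := Nat.find_spec hex
    have i2 := Nat.find_min hex (m := q) (by omega)
    have i3 : Nat.find hex ≤ m := Nat.find_min' hex h₁.ge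
    rw [hq] at i1 i3
    have i4 := U.Bl_succ q ω
    exact key (q + 1) (ih (by omega) (by omega) fun p hp hpm hpk => by
      have hmem : q + 1 ∈ {n : ℕ | U.tau k ω < n ∧ U.Bl n ω = U.Bl (n - 1) ω + 1} :=
        ⟨by omega, by rw [Nat.add_sub_cancel]; omega⟩
      refine le_antisymm (Nat.sInf_le hmem) (le_csInf ⟨_, hmem⟩ fun n hn => ?_)
      obtain ⟨hn1, hn2⟩ := hn
      by_contra hlt
      have i1 := U.Bl_mono ω (by omega : p ≤ n - 1)
      have i2 := U.Bl_mono ω (by omega : n ≤ q)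
      simp only at i1 i2
      omega) i3 (by omega)

/-- The event that the urn leaves the state `(i, j)` with `i'` blue balls. -/
def exitSet (U : Urn μ b r) (i j i' : ℕ) : Set Ω :=
  {ω | U.Bl (i + j) ω = i ∧ U.Bl (i + j + 1) ω = i'}

theorem measurableSet_exitSet (U : Urn μ b r) (i j i' : ℕ) : MeasurableSet (U.exitSet i j i') :=
  (U.meas_Bl _ (measurableSet_singleton i)).inter (U.meas_Bl _ (measurableSet_singleton i'))

theorem measureReal_exitSet_add [IsProbabilityMeasure μ] (U : Urn μ b r) (i j : ℕ) :
    μ.real (U.exitSet i j (i + 1)) + μ.real (U.exitSet i j i)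
      = μ.real {ω | U.Bl (i + j) ω = i} := by
  rw [← measureReal_union _ (U.measurableSet_exitSet i j i)]
  · congr 1
    ext ω
    simp only [exitSet, Set.mem_union, Set.mem_ofPred_eq]
    have := U.Bl_succ (i + j) ω
    omega
  · rw [Set.disjoint_left]
    rintro ω ⟨_, h1⟩ ⟨_, h2⟩
    omega

theorem measureReal_exitSet [IsProbabilityMeasure μ] (U : Urn μ b r) (i j : ℕ) :
    μ.real (U.exitSet i j (i + 1)) = b i / (b i + r j) * μ.real {ω | U.Bl (i + j) ω = i} := by
  set S := {ω | U.Bl (i + j) ω = i} with hS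
  have hle : (⨆ k ∈ Set.Iic (i + j), MeasurableSpace.comap
      (fun ω => (U.Bl k ω, U.Re k ω)) inferInstance) ≤ ‹MeasurableSpace Ω› :=
    iSup₂_le fun k _ => ((U.meas_Bl k).prodMk (U.meas_Re k)).comap_le
  have hSm : MeasurableSet[⨆ k ∈ Set.Iic (i + j), MeasurableSpace.comap
      (fun ω => (U.Bl k ω, U.Re k ω)) inferInstance] S := by
    have h1 : MeasurableSpace.comap (fun ω => (U.Bl (i + j) ω, U.Re (i + j) ω)) inferInstance ≤
        ⨆ k ∈ Set.Iic (i + j), MeasurableSpace.comap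
          (fun ω => (U.Bl k ω, U.Re k ω)) inferInstance :=
      le_iSup₂_of_le (i + j) (Set.mem_Iic.2 le_rfl) le_rfl
    exact h1 _ ⟨{p | p.1 = i}, measurable_fst (measurableSet_singleton i), rfl⟩
  have hT : MeasurableSet {ω | U.Bl (i + j + 1) ω = U.Bl (i + j) ω + 1} :=
    measurableSet_eq_fun (U.meas_Bl _) ((U.meas_Bl _).add_const 1)
  have hf : (fun ω => if U.Bl (i + j + 1) ω = U.Bl (i + j) ω + 1 then (1 : ℝ) else 0)
      = {ω | U.Bl (i + j + 1) ω = U.Bl (i + j) ω + 1}.indicator fun _ => 1 := by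
    ext ω
    simp [Set.indicator_apply]
  have h_integrable : Integrable
      (fun ω => if U.Bl (i + j + 1) ω = U.Bl (i + j) ω + 1 then (1 : ℝ) else 0) μ := by
    rw [hf]
    exact (integrable_const 1).indicator hT
  have h1 := setIntegral_condExp hle h_integrable hSm
  rw [setIntegral_congr_ae (g := fun _ => b i / (b i + r j)) (hle _ hSm), hf,
    setIntegral_indicator hT] at h1
  · simp only [setIntegral_const, smul_eq_mul, mul_one] at h1
    rw [mul_comm, h1]
    congr 1
    ext ω
    simp only [exitSet, hS, Set.mem_inter_iff, Set.mem_ofPred_eq]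
    omega
  · filter_upwards [U.markov (i + j)] with ω hω hωS
    have h2 : U.Bl (i + j) ω = i := hωS
    have h3 : U.Re (i + j) ω = j := by have := U.Bl_add_Re (i + j) ω; omega
    rw [hω, h2, h3]

theorem isFlux [IsProbabilityMeasure μ] (U : Urn μ b r) (hb : ∀ i, 0 < b i)
    (hbr : ∀ i, r i = b i) :
    IsFlux (fun l => 1 / b l) (fun i j => μ.real (U.exitSet i j (i + 1)))
      (fun i j => μ.real (U.exitSet i j i)) where
  e_nonneg i j := measureReal_nonneg
  g_nonneg i j := measureReal_nonneg
  zero_zero := by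
    rw [measureReal_exitSet_add]
    simp [U.init_Bl]
  zero_succ j := by
    rw [measureReal_exitSet_add]
    congr 1
    ext ω
    simp only [exitSet, Set.mem_ofPred_eq, zero_add]
    have := U.Bl_succ j ω
    omega
  succ_zero i := by
    rw [measureReal_exitSet_add]
    congr 1
    ext ω
    simp only [exitSet, Set.mem_ofPred_eq, add_zero]
    have := U.Bl_succ i ω
    have := U.Bl_add_Re i ω
    omega
  succ_succ i j := by
    rw [measureReal_exitSet_add, ← measureReal_union _ (U.measurableSet_exitSet _ _ _)]
    · congr 1
      ext ω
      simp only [exitSet, Set.mem_union, Set.mem_ofPred_eq]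
      rw [show i + 1 + (j + 1) = i + 1 + j + 1 by ring, show i + (j + 1) = i + 1 + j by ring]
      have := U.Bl_succ (i + 1 + j) ω
      omega
    · rw [Set.disjoint_left]
      rintro ω ⟨h1, _⟩ ⟨h2, _⟩
      rw [show i + (j + 1) = i + 1 + j by ring] at h1
      omega
  balance i j := by
    have h1 := U.measureReal_exitSet i j
    rw [← measureReal_exitSet_add, hbr] at h1
    have hi := hb i
    have hj := hb j
    field_simp at h1 ⊢
    linarith

theorem integral_D_tau [IsProbabilityMeasure μ] (U : Urn μ b r) {n : ℕ} (hn : 0 < n)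
    (h₁ : HasSum (fun j => μ.real (U.exitSet (n - 1) j (n - 1 + 1))) 1)
    (h₂ : Summable fun j : ℕ => μ.real (U.exitSet (n - 1) j (n - 1 + 1)) * ((j : ℝ) - n)) :
    ∫ ω, (U.D (U.tau n ω) ω : ℝ) ∂μ
      = ∑' j : ℕ, μ.real (U.exitSet (n - 1) j (n - 1 + 1)) * ((j : ℝ) - n) := by
  obtain ⟨k, rfl⟩ := Nat.exists_eq_succ_of_ne_zero hn.ne'
  simp only [Nat.succ_eq_add_one, Nat.add_sub_cancel] at h₁ h₂ ⊢
  set s : ℕ → Set Ω := fun j => U.exitSet k j (k + 1)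
  have hm : ∀ j, MeasurableSet (s j) := fun j => U.measurableSet_exitSet _ _ _
  have hval : ∀ j, ∀ ω ∈ s j, (U.D (U.tau (k + 1) ω) ω : ℝ) = (j : ℝ) - ((k + 1 : ℕ) : ℝ) := by
    rintro j ω ⟨i1, i2⟩
    have i3 := U.Bl_add_Re (k + j + 1) ω
    have i4 : U.Re (k + j + 1) ω = j := by omega
    rw [U.tau_succ_eq i1 i2, D, i2, i4]
    push_cast
    ring
  have hd : Pairwise (Function.onFun Disjoint s) := by
    intro i j hij
    rw [Function.onFun, Set.disjoint_left]
    rintro ω ⟨i1, i2⟩ ⟨j1, j2⟩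
    have i3 := U.tau_succ_eq i1 i2
    have i4 := U.tau_succ_eq j1 j2
    omega
  have hone : HasSum (fun j => μ.real (s j)) (μ.real (⋃ j, s j)) := by
    simpa using hasSum_integral_iUnion (f := fun _ => (1 : ℝ)) (μ := μ) hm hd
      (integrable_const 1).integrableOn
  have hae : ∀ᵐ ω ∂μ, ω ∈ ⋃ j, s j :=
    (mem_ae_iff_prob_eq_one (MeasurableSet.iUnion hm)).2
      ((ENNReal.toReal_eq_one_iff _).1 (hone.unique h₁))
  have h_integrable : IntegrableOn (fun ω => (U.D (U.tau (k + 1) ω) ω : ℝ)) (⋃ j, s j) μ := by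
    refine integrableOn_iUnion_of_summable_integral_norm (fun j => ?_) ?_
    · exact (integrableOn_congr_fun (hval j) (hm j)).2 (integrable_const _).integrableOn
    · refine h₂.abs.congr fun j => ?_
      rw [setIntegral_congr_fun (g := fun _ => |(j : ℝ) - ((k + 1 : ℕ) : ℝ)|) (hm j)
        fun ω hω => by rw [Real.norm_eq_abs, hval j ω hω]]
      rw [setIntegral_const, smul_eq_mul, abs_mul, abs_of_nonneg measureReal_nonneg]
  have hsum := hasSum_integral_iUnion hm hd h_integrable
  rw [Measure.restrict_eq_self_of_ae_mem hae] at hsum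
  rw [← hsum.tsum_eq]
  refine tsum_congr fun j => ?_
  rw [setIntegral_congr_fun (hm j) (hval j), setIntegral_const, smul_eq_mul]

end Path

end Urn

theorem mean_discrepancy_at_tau_limit_zero {Ω : Type*} [MeasurableSpace Ω] (μ : MeasureTheory.Measure Ω) [MeasureTheory.IsProbabilityMeasure μ]
    (α B : ℝ) (hα : 0 < α) (w : ℕ → ℝ) (hw : ∀ n, 0 < w n)
    (hasymp : WeightAsymp w α B)
    (b r : ℕ → ℝ) (hb : ∀ i, 0 < b i) (hr : ∀ i, 0 < r i)
    (hbr : ∀ i, b i = w (2*i) ∧ r i = w (2*i)) (U : Urn μ b r) :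
    Tendsto (fun n : ℕ => ∫ ω, (U.D (U.tau n ω) ω : ℝ) ∂μ)
      atTop (nhds (-α / (2*α + 1))) := by
  have hf := (U.isFlux hb fun i => by rw [(hbr i).1, (hbr i).2]).const_mul (2 ^ α : ℝ)⁻¹
  simp only [fun i => (hbr i).1] at hf
  have hpl := PowerLaw.of_weightAsymp hα hw hasymp
  obtain ⟨C, c, hC⟩ := hpl.exists_nearLinear
  refine (hpl.tendsto_tsum_mean hf).congr' ?_
  filter_upwards [eventually_gt_atTop 0] with n hn
  exact (U.integral_D_tau hn (hasSum_weight hC hf hn) (summable_mean hC hf hn)).symm
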